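/- arXiv:2410.09257 — 2 statements merged into one kernel-verified Lean document; each statement's English description precedes it below -/
import Mathlib

section
/- Every finite two-person shortest-path game with positive arc costs has a Nash equilibrium in pure stationary strategies. -/
open scoped Classical

variable {V : Type*}

/-- A terminal position: a vertex with no outgoing arcs. -/
def IsTerm (E : V → V → Prop) (v : V) : Prop := ∀ w, ¬ E v w

/-- The cost, for a player with local costs `r`, of the play starting at `s` determined by
the combined successor function `f`: the sum of the local costs along the play if it
reaches a terminal, and `+∞` otherwise. -/
noncomputable def playCost (E : V → V → Prop) (r : V → V → ℝ) (f : V → V) (s : V) : EReal :=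
  if h : ∃ n, IsTerm E (f^[n] s) then
    (((Finset.range (Nat.find h)).sum fun i => r (f^[i] s) (f^[i + 1] s) : ℝ) : EReal)
  else ⊤

/-- The combined successor function of a strategy pair. -/
noncomputable def nextFun (V1 : Set V) (σ1 σ2 : V → V) : V → V :=
  fun u => if u ∈ V1 then σ1 u else σ2 u

/-- `(σ1, σ2)` is a Nash equilibrium (in pure stationary strategies) of the two-person
shortest-path game: both strategies are legal, and no player can strictly decrease
their own cost by a unilateral deviation. -/
def IsNE (E : V → V → Prop) (V1 V2 : Set V) (r1 r2 : V → V → ℝ) (s : V)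
    (σ1 σ2 : V → V) : Prop :=
  (∀ u ∈ V1, E u (σ1 u)) ∧ (∀ u ∈ V2, E u (σ2 u)) ∧
  (∀ σ1', (∀ u ∈ V1, E u (σ1' u)) →
    playCost E r1 (nextFun V1 σ1 σ2) s ≤ playCost E r1 (nextFun V1 σ1' σ2) s) ∧
  (∀ σ2', (∀ u ∈ V2, E u (σ2' u)) →
    playCost E r2 (nextFun V1 σ1 σ2) s ≤ playCost E r2 (nextFun V1 σ1 σ2') s)

/-- `v` solves the optimality equations of the zero-sum game with local costs `r` in which the
owner of `A` minimizes and the owner of `B` maximizes the total cost until a terminal. -/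
structure IsMinimaxValue (E : V → V → Prop) (A B : Set V) (r : V → V → ℝ)
    (v : V → ENNReal) : Prop where
  eq_zero : ∀ u, IsTerm E u → v u = 0
  min_le : ∀ u ∈ A, ∀ x, E u x → v u ≤ ENNReal.ofReal (r u x) + v x
  min_attained : ∀ u ∈ A, ∃ x, E u x ∧ v u = ENNReal.ofReal (r u x) + v x
  le_max : ∀ u ∈ B, ∀ x, E u x → ENNReal.ofReal (r u x) + v x ≤ v u
  max_attained : ∀ u ∈ B, ∃ x, E u x ∧ v u = ENNReal.ofReal (r u x) + v x

/-- The owner of `A` cannot decrease the cost of the play of `f` from `s` as long as the moves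
on the opponent's positions `B` are those of `f`. -/
def IsStableFor (E : V → V → Prop) (A B : Set V) (r : V → V → ℝ) (f : V → V) (s : V) : Prop :=
  ∀ g : V → V, (∀ u ∈ A, E u (g u)) → (∀ u ∈ B, g u = f u) →
    playCost E r f s ≤ playCost E r g s

theorem exists_isMinimaxValue [Finite V] (E : V → V → Prop) (A B : Set V) (r : V → V → ℝ)
    (hpart : ∀ v, ¬ IsTerm E v ↔ v ∈ A ∪ B) (hdisj : Disjoint A B) :
    ∃ v, IsMinimaxValue E A B r v := by
  let T : (V → ENNReal) →o (V → ENNReal) :=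
    { toFun := fun v u => if IsTerm E u then 0 else
        if u ∈ A then ⨅ x : {x // E u x}, (ENNReal.ofReal (r u x) + v x)
        else ⨆ x : {x // E u x}, (ENNReal.ofReal (r u x) + v x)
      monotone' := by
        intro v w hvw u
        dsimp only
        split_ifs
        · exact le_rfl
        · exact iInf_mono fun x => by gcongr; exact hvw _
        · exact iSup_mono fun x => by gcongr; exact hvw _ }
  obtain ⟨v, hfix⟩ : ∃ v : V → ENNReal, ∀ u, v u = if IsTerm E u then 0 else
        if u ∈ A then ⨅ x : {x // E u x}, (ENNReal.ofReal (r u x) + v x)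
        else ⨆ x : {x // E u x}, (ENNReal.ofReal (r u x) + v x) :=
    ⟨OrderHom.lfp T, fun u => congrFun (OrderHom.map_lfp T).symm u⟩
  have hne : ∀ u, u ∈ A ∪ B → Nonempty {x // E u x} := fun u hu => by
    have := (hpart u).2 hu
    simp only [IsTerm, not_forall, not_not] at this
    exact ⟨⟨_, this.choose_spec⟩⟩
  have hA : ∀ u ∈ A, v u = ⨅ x : {x // E u x}, (ENNReal.ofReal (r u x) + v x) := by
    intro u hu
    have h := (hpart u).2 (Or.inl hu)
    rw [hfix u, if_neg h, if_pos hu]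
  have hB : ∀ u ∈ B, v u = ⨆ x : {x // E u x}, (ENNReal.ofReal (r u x) + v x) := by
    intro u hu
    have h := (hpart u).2 (Or.inr hu)
    have hu' : u ∉ A := fun h => Set.disjoint_left.1 hdisj h hu
    rw [hfix u, if_neg h, if_neg hu']
  refine ⟨v, ⟨?_, ?_, ?_, ?_, ?_⟩⟩
  · intro u hu
    rw [hfix u, if_pos hu]
  · intro u hu x hx
    rw [hA u hu]
    exact iInf_le (fun x : {x // E u x} => ENNReal.ofReal (r u x) + v x) ⟨x, hx⟩
  · intro u hu
    have := hne u (Or.inl hu)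
    obtain ⟨x, hx⟩ := exists_eq_ciInf_of_finite
      (f := fun x : {x // E u x} => ENNReal.ofReal (r u x) + v x)
    exact ⟨x, x.2, by rw [hA u hu]; exact hx.symm⟩
  · intro u hu x hx
    rw [hB u hu]
    exact le_iSup (fun x : {x // E u x} => ENNReal.ofReal (r u x) + v x) ⟨x, hx⟩
  · intro u hu
    have := hne u (Or.inr hu)
    obtain ⟨x, hx⟩ := exists_eq_ciSup_of_finite
      (f := fun x : {x // E u x} => ENNReal.ofReal (r u x) + v x)
    exact ⟨x, x.2, by rw [hB u hu]; exact hx.symm⟩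

theorem playCost_eq_sum {E : V → V → Prop} {r : V → V → ℝ} {f : V → V} {s : V} {n : ℕ}
    (hn : IsTerm E (f^[n] s)) (hlt : ∀ i < n, ¬ IsTerm E (f^[i] s)) :
    playCost E r f s
      = (((Finset.range n).sum fun i => r (f^[i] s) (f^[i + 1] s) : ℝ) : EReal) := by
  have h : ∃ n, IsTerm E (f^[n] s) := ⟨n, hn⟩
  rw [playCost, dif_pos h, (Nat.find_eq_iff h).2 ⟨hn, hlt⟩]

theorem playCost_eq_top {E : V → V → Prop} {r : V → V → ℝ} {f : V → V} {s : V}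
    (h : ∀ n, ¬ IsTerm E (f^[n] s)) : playCost E r f s = ⊤ := by
  rw [playCost, dif_neg (by simpa using h)]

/-- A play visits no vertex twice before it reaches a terminal. -/
theorem injOn_iterate_of_isTerm {E : V → V → Prop} {f : V → V} {s : V} {n : ℕ}
    (hn : IsTerm E (f^[n] s)) (hlt : ∀ i < n, ¬ IsTerm E (f^[i] s)) :
    Set.InjOn (fun i => f^[i] s) (Finset.range n : Set ℕ) := by
  have key : ∀ i j, i < j → j < n → f^[i] s ≠ f^[j] s := by
    intro i j hij hj h
    apply hlt (n - j + i) (by omega)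
    rw [Function.iterate_add_apply, h, ← Function.iterate_add_apply, Nat.sub_add_cancel hj.le]
    exact hn
  intro i hi j hj h
  simp only [Finset.coe_range, Set.mem_Iio] at hi hj
  rcases lt_trichotomy i j with hij | hij | hij
  · exact absurd h (key i j hij hj)
  · exact hij
  · exact absurd h.symm (key j i hij hi)

/-- If the value at `s` is infinite and the maximizer plays optimally then no play from `s`
reaches a terminal. -/
theorem playCost_eq_top_of_value_eq_top {E : V → V → Prop} {A B : Set V} {r r' : V → V → ℝ}
    {v : V → ENNReal} (hv : IsMinimaxValue E A B r v)
    (hpart : ∀ v, ¬ IsTerm E v ↔ v ∈ A ∪ B) {g : V → V} {s : V} (hs : v s = ⊤)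
    (hA : ∀ u ∈ A, E u (g u))
    (hB : ∀ u ∈ B, v u = ENNReal.ofReal (r u (g u)) + v (g u)) :
    playCost E r' g s = ⊤ := by
  have hstep : ∀ u, v u = ⊤ → v (g u) = ⊤ := by
    intro u hu
    have hnt : ¬ IsTerm E u := fun h => by simp [hv.eq_zero u h] at hu
    rcases (hpart u).1 hnt with h | h
    · have := hv.min_le u h _ (hA u h)
      rw [hu, top_le_iff, ENNReal.add_eq_top] at this
      simpa using this
    · have := hB u h
      rw [hu, eq_comm, ENNReal.add_eq_top] at this
      simpa using this
  have htop : ∀ n, v (g^[n] s) = ⊤ := by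
    intro n
    induction n with
    | zero => exact hs
    | succ n ih => rw [Function.iterate_succ_apply']; exact hstep _ ih
  refine playCost_eq_top fun n hn => ?_
  have := htop n
  simp [hv.eq_zero _ hn] at this

/-- If the arc costs never exceed the drop of the potential `v` along the moves of `f`, then the
play of `f` from a vertex with finite potential reaches a terminal. -/
theorem exists_isTerm_iterate [Finite V] {E : V → V → Prop} {r : V → V → ℝ}
    {v : V → ENNReal} (hpos : ∀ u x, E u x → 0 < r u x)
    {f : V → V} (hf : ∀ u, ¬ IsTerm E u → E u (f u))
    (hle : ∀ u, ¬ IsTerm E u → ENNReal.ofReal (r u (f u)) + v (f u) ≤ v u)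
    {s : V} (hs : v s ≠ ⊤) : ∃ n, IsTerm E (f^[n] s) := by
  by_contra! hnt
  have hfin : ∀ n, v (f^[n] s) ≠ ⊤ := by
    intro n
    induction n with
    | zero => exact hs
    | succ n ih =>
      rw [Function.iterate_succ_apply']
      exact ne_top_of_le_ne_top ih (le_trans le_add_self (hle _ (hnt n)))
  have hanti : StrictAnti fun n => v (f^[n] s) := by
    refine strictAnti_nat_of_succ_lt fun n => ?_
    have h1 := hle _ (hnt n)
    have h2 := hpos _ _ (hf _ (hnt n))
    rw [← Function.iterate_succ_apply' f] at h1 h2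
    refine lt_of_lt_of_le ?_ h1
    rw [add_comm (ENNReal.ofReal _)]
    exact ENNReal.lt_add_right (hfin (n + 1)) (ENNReal.ofReal_pos.2 h2).ne'
  have hinj : Function.Injective fun n => f^[n] s := fun i j h =>
    hanti.injective (congrArg v h)
  exact not_injective_infinite_finite _ hinj

/-- Suppose the play of `f` from `s` uses optimal moves of the minimizer, and that off this
play the maximizer's moves are optimal. Then the minimizer has no profitable deviation. -/
theorem isStableFor_of_optimal [Finite V] {E : V → V → Prop} {A B : Set V} {r : V → V → ℝ}
    {v : V → ENNReal} (hv : IsMinimaxValue E A B r v)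
    (hpart : ∀ v, ¬ IsTerm E v ↔ v ∈ A ∪ B)
    (hpos : ∀ u x, E u x → 0 < r u x) {f : V → V} {s : V} {m : ℕ}
    (hf : ∀ u, ¬ IsTerm E u → E u (f u))
    (hfA : ∀ u ∈ A, v u = ENNReal.ofReal (r u (f u)) + v (f u))
    (hm : IsTerm E (f^[m] s)) (hlt : ∀ i < m, ¬ IsTerm E (f^[i] s))
    (hfB : ∀ u ∈ B, (∀ i < m, f^[i] s ≠ u) → v u = ENNReal.ofReal (r u (f u)) + v (f u))
    (hs : v s ≠ ⊤) : IsStableFor E A B r f s := by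
  have := Fintype.ofFinite V
  intro g hgA hgB
  by_cases hg : ∃ n, IsTerm E (g^[n] s)
  swap
  · rw [playCost_eq_top (f := g) (by simpa using hg)]
    exact le_top
  obtain ⟨n, hn, hltn⟩ : ∃ n, IsTerm E (g^[n] s) ∧ ∀ i < n, ¬ IsTerm E (g^[i] s) :=
    ⟨Nat.find hg, Nat.find_spec hg, fun i hi => Nat.find_min hg hi⟩
  rw [playCost_eq_sum hm hlt, playCost_eq_sum hn hltn, EReal.coe_le_coe_iff]
  have hle : ∀ u, ¬ IsTerm E u → ENNReal.ofReal (r u (f u)) + v (f u) ≤ v u := by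
    intro u hu
    rcases (hpart u).1 hu with h | h
    · exact (hfA u h).ge
    · exact hv.le_max u h _ (hf u hu)
  have hffin : ∀ i ≤ m, v (f^[i] s) ≠ ⊤ := by
    intro i
    induction i with
    | zero => intro _; exact hs
    | succ i ih =>
      intro hi
      rw [Function.iterate_succ_apply']
      exact ne_top_of_le_ne_top (ih (by omega)) (le_trans le_add_self (hle _ (hlt i (by omega))))
  have hback : ∀ u, ¬ IsTerm E u → v (g u) ≠ ⊤ → v u ≠ ⊤ := by
    intro u hu hgu
    rcases (hpart u).1 hu with h | h
    · exact ne_top_of_le_ne_top (ENNReal.add_ne_top.2 ⟨ENNReal.ofReal_ne_top, hgu⟩)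
        (hv.min_le u h _ (hgA u h))
    · by_cases hP : ∀ i < m, f^[i] s ≠ u
      · rw [hfB u h hP, ← hgB u h]
        exact ENNReal.add_ne_top.2 ⟨ENNReal.ofReal_ne_top, hgu⟩
      · push Not at hP
        obtain ⟨i, hi, rfl⟩ := hP
        exact hffin i hi.le
  have hgfin : ∀ i ≤ n, v (g^[i] s) ≠ ⊤ := by
    intro i hi
    induction hi using Nat.decreasingInduction with
    | self => simp [hv.eq_zero _ hn]
    | of_succ i hi ih =>
      rw [Function.iterate_succ_apply'] at ih
      exact hback _ (hltn i hi) ih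
  let w : V → ℝ := fun u => (v u).toReal
  let P : Finset V := (Finset.range m).image fun i => f^[i] s
  let b : V → ℝ := fun u => if u ∈ P then r u (f u) + w (f u) - w u else 0
  have hreal : ∀ u x, E u x → v x ≠ ⊤ →
      (ENNReal.ofReal (r u x) + v x).toReal = r u x + w x := by
    intro u x hux hx
    rw [ENNReal.toReal_add ENNReal.ofReal_ne_top hx,
      ENNReal.toReal_ofReal (hpos u x hux).le]
  have hb : ∀ u, b u ≤ 0 := by
    intro u
    by_cases hu : u ∈ P
    · obtain ⟨i, hi, rfl⟩ := Finset.mem_image.1 hu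
      rw [Finset.mem_range] at hi
      have hfi : v (f (f^[i] s)) ≠ ⊤ := by
        rw [← Function.iterate_succ_apply' f]; exact hffin (i + 1) hi
      have h := ENNReal.toReal_mono (hffin i hi.le) (hle _ (hlt i hi))
      rw [hreal _ _ (hf _ (hlt i hi)) hfi] at h
      simp only [b, if_pos hu]
      change _ ≤ w _ at h
      linarith
    · simp [b, hu]
  have hstep : ∀ i < n, b (g^[i] s) ≤
      r (g^[i] s) (g^[i + 1] s) + w (g^[i + 1] s) - w (g^[i] s) := by
    intro i hi
    have h1 := hgfin i hi.le
    have h2 := hgfin (i + 1) hi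
    have h3 := hltn i hi
    rw [Function.iterate_succ_apply'] at h2 ⊢
    generalize g^[i] s = u at h1 h2 h3 ⊢
    rcases (hpart u).1 h3 with h | h
    · have h4 := ENNReal.toReal_mono (ENNReal.add_ne_top.2 ⟨ENNReal.ofReal_ne_top, h2⟩)
        (hv.min_le u h _ (hgA u h))
      rw [hreal _ _ (hgA u h) h2] at h4
      change w u ≤ _ at h4
      linarith [hb u]
    · rw [hgB u h] at h2 ⊢
      by_cases hu : u ∈ P
      · simp [b, hu]
      · have h4 := congrArg ENNReal.toReal (hfB u h fun i hi hiu =>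
          hu (Finset.mem_image.2 ⟨i, Finset.mem_range.2 hi, hiu⟩))
        rw [hreal _ _ (hf u h3) h2] at h4
        change w u = _ at h4
        simp only [b, if_neg hu]
        linarith
  have hsumb : ∑ u ∈ P, b u ≤ ∑ i ∈ Finset.range n, b (g^[i] s) := by
    rw [← Finset.sum_image (g := fun i => g^[i] s) (f := b) (injOn_iterate_of_isTerm hn hltn)]
    have h1 : ∑ u ∈ P, b u = ∑ u, b u :=
      Finset.sum_subset (Finset.subset_univ _) fun u _ hu => by simp [b, hu]
    rw [h1]
    have h2 := Finset.sum_le_sum_of_subset_of_nonneg (f := fun u => - b u)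
      (Finset.subset_univ ((Finset.range n).image fun i => g^[i] s))
      fun u _ _ => neg_nonneg.2 (hb u)
    simp only [Finset.sum_neg_distrib] at h2
    exact neg_le_neg_iff.1 h2
  have hsumP : ∑ u ∈ P, b u = ∑ i ∈ Finset.range m,
      (r (f^[i] s) (f^[i + 1] s) + w (f^[i + 1] s) - w (f^[i] s)) := by
    rw [Finset.sum_image (injOn_iterate_of_isTerm hm hlt)]
    refine Finset.sum_congr rfl fun i hi => ?_
    have : f^[i] s ∈ P := Finset.mem_image_of_mem _ hi
    simp only [b, if_pos this, Function.iterate_succ_apply']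
  have hsumg := Finset.sum_le_sum fun i hi => hstep i (Finset.mem_range.1 hi)
  simp only [add_sub_assoc, Finset.sum_add_distrib] at hsumP hsumg
  rw [Finset.sum_range_sub (fun i => w (f^[i] s))] at hsumP
  rw [Finset.sum_range_sub (fun i => w (g^[i] s))] at hsumg
  have hwm : w (f^[m] s) = 0 := by simp [w, hv.eq_zero _ hm]
  have hwn : w (g^[n] s) = 0 := by simp [w, hv.eq_zero _ hn]
  simp only [hwm, hwn, Function.iterate_zero, id] at hsumP hsumg
  linarith

/-- If the owner of `A` can force a terminal from `s`, then there is a pair of strategies,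
combined into a successor function, that is stable for both players. -/
theorem exists_stable_of_value_ne_top [Finite V] {E : V → V → Prop} {A B : Set V}
    {r : V → V → ℝ} {v : V → ENNReal} (r' : V → V → ℝ) (hv : IsMinimaxValue E A B r v)
    (hpart : ∀ v, ¬ IsTerm E v ↔ v ∈ A ∪ B) (hdisj : Disjoint A B)
    (hpos : ∀ u x, E u x → 0 < r u x) {s : V} (hs : v s ≠ ⊤) :
    ∃ f : V → V, (∀ u, ¬ IsTerm E u → E u (f u)) ∧
      IsStableFor E A B r f s ∧ IsStableFor E B A r' f s := by
  have hopt : ∀ u, ∃ x, ¬ IsTerm E u → E u x ∧ v u = ENNReal.ofReal (r u x) + v x := by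
    intro u
    by_cases hu : IsTerm E u
    · exact ⟨u, fun h => absurd hu h⟩
    · rcases (hpart u).1 hu with h | h
      · exact (hv.min_attained u h).imp fun _ hx _ => hx
      · exact (hv.max_attained u h).imp fun _ hx _ => hx
  choose o ho using hopt
  have hAnt : ∀ u ∈ A, ¬ IsTerm E u := fun u hu => (hpart u).2 (Or.inl hu)
  have hBnt : ∀ u ∈ B, ¬ IsTerm E u := fun u hu => (hpart u).2 (Or.inr hu)
  have hAB : ∀ u ∈ A, u ∉ B := fun u hu h => Set.disjoint_left.1 hdisj hu h
  obtain ⟨f, ⟨hf, hfA⟩, hmin⟩ := Set.exists_min_image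
    {f : V → V | (∀ u, ¬ IsTerm E u → E u (f u)) ∧ ∀ u ∈ A, f u = o u}
    (fun f => playCost E r' f s) (Set.toFinite _)
    ⟨o, fun u hu => (ho u hu).1, fun _ _ => rfl⟩
  have hex := exists_isTerm_iterate hpos hf (fun u hu => by
    rcases (hpart u).1 hu with h | h
    · rw [hfA u h]; exact (ho u hu).2.ge
    · exact hv.le_max u h _ (hf u hu)) hs
  obtain ⟨m, hm, hlt⟩ : ∃ m, IsTerm E (f^[m] s) ∧ ∀ i < m, ¬ IsTerm E (f^[i] s) :=
    ⟨Nat.find hex, Nat.find_spec hex, fun i hi => Nat.find_min hex hi⟩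
  let p : V → V := fun u => if u ∈ B ∧ ∀ i < m, f^[i] s ≠ u then o u else f u
  have hpf : ∀ i ≤ m, p^[i] s = f^[i] s := by
    intro i
    induction i with
    | zero => intro _; rfl
    | succ i ih =>
      intro hi
      rw [Function.iterate_succ_apply', Function.iterate_succ_apply', ih (by omega)]
      exact if_neg fun h => h.2 i (by omega) rfl
  have hp : ∀ u, ¬ IsTerm E u → E u (p u) := by
    intro u hu
    simp only [p]
    split_ifs
    · exact (ho u hu).1
    · exact hf u hu
  have hpA : ∀ u ∈ A, p u = o u := by
    intro u hu
    simp [p, hAB u hu, hfA u hu]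
  have hpm : IsTerm E (p^[m] s) := by rw [hpf m le_rfl]; exact hm
  have hplt : ∀ i < m, ¬ IsTerm E (p^[i] s) := fun i hi => by
    rw [hpf i hi.le]; exact hlt i hi
  refine ⟨p, hp, isStableFor_of_optimal hv hpart hpos hp ?_ hpm hplt ?_ hs, ?_⟩
  · intro u hu
    rw [hpA u hu]
    exact (ho u (hAnt u hu)).2
  · intro u hu hP
    have : p u = o u := if_pos ⟨hu, fun i hi => by rw [← hpf i hi.le]; exact hP i hi⟩
    rw [this]
    exact (ho u (hBnt u hu)).2
  · intro g hgB hgp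
    have hcost : playCost E r' p s = playCost E r' f s := by
      rw [playCost_eq_sum hpm hplt, playCost_eq_sum hm hlt]
      refine congrArg _ (Finset.sum_congr rfl fun i hi => ?_)
      have := Finset.mem_range.1 hi
      rw [hpf i this.le, hpf (i + 1) this]
    rw [hcost]
    refine hmin g ⟨fun u hu => ?_, fun u hu => ?_⟩
    · rcases (hpart u).1 hu with h | h
      · rw [hgp u h]; exact hp u hu
      · exact hgB u h
    · rw [hgp u hu]; exact hpA u hu

theorem exists_stable [Finite V] (E : V → V → Prop) (A B : Set V) (s : V) (r r' : V → V → ℝ)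
    (hpart : ∀ v, ¬ IsTerm E v ↔ v ∈ A ∪ B) (hdisj : Disjoint A B)
    (hpos : ∀ u x, E u x → 0 < r u x) (hpos' : ∀ u x, E u x → 0 < r' u x) :
    ∃ f : V → V, (∀ u, ¬ IsTerm E u → E u (f u)) ∧
      IsStableFor E A B r f s ∧ IsStableFor E B A r' f s := by
  have hpart' : ∀ v, ¬ IsTerm E v ↔ v ∈ B ∪ A := by simpa only [Set.union_comm] using hpart
  obtain ⟨v, hv⟩ := exists_isMinimaxValue E A B r hpart hdisj
  obtain ⟨v', hv'⟩ := exists_isMinimaxValue E B A r' hpart' hdisj.symm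
  by_cases hs : v s = ⊤
  swap
  · exact exists_stable_of_value_ne_top r' hv hpart hdisj hpos hs
  by_cases hs' : v' s = ⊤
  swap
  · obtain ⟨f, hf, h1, h2⟩ :=
      exists_stable_of_value_ne_top r hv' hpart' hdisj.symm hpos' hs'
    exact ⟨f, hf, h2, h1⟩
  have hAB : ∀ u ∈ A, u ∉ B := fun u hu h => Set.disjoint_left.1 hdisj hu h
  have hopt : ∀ u, ∃ x,
      (u ∈ A → E u x ∧ v' u = ENNReal.ofReal (r' u x) + v' x) ∧
      (u ∈ B → E u x ∧ v u = ENNReal.ofReal (r u x) + v x) := by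
    intro u
    by_cases hA : u ∈ A
    · obtain ⟨x, hx⟩ := hv'.max_attained u hA
      exact ⟨x, fun _ => hx, fun h => absurd h (hAB u hA)⟩
    · by_cases hB : u ∈ B
      · obtain ⟨x, hx⟩ := hv.max_attained u hB
        exact ⟨x, fun h => absurd h hA, fun _ => hx⟩
      · exact ⟨u, fun h => absurd h hA, fun h => absurd h hB⟩
  choose f hfA hfB using hopt
  refine ⟨f, fun u hu => ?_, fun g hgA hgf => ?_, fun g hgB hgf => ?_⟩
  · rcases (hpart u).1 hu with h | h
    · exact (hfA u h).1
    · exact (hfB u h).1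
  · rw [playCost_eq_top_of_value_eq_top (g := g) hv hpart hs hgA fun u hu => by
      rw [hgf u hu]; exact (hfB u hu).2]
    exact le_top
  · rw [playCost_eq_top_of_value_eq_top (g := g) hv' hpart' hs' hgB fun u hu => by
      rw [hgf u hu]; exact (hfA u hu).2]
    exact le_top

/-- every finite two-person shortest-path game with positive arc costs has a
Nash equilibrium in pure stationary strategies. -/
theorem finite_positive_SP_game_has_NE [Fintype V]
    (E : V → V → Prop) (V1 V2 : Set V) (s : V) (r1 r2 : V → V → ℝ)
    (hpart : ∀ v, ¬ IsTerm E v ↔ v ∈ V1 ∪ V2)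
    (hdisj : Disjoint V1 V2)
    (hpos : ∀ u v, E u v → 0 < r1 u v ∧ 0 < r2 u v) :
    ∃ σ1 σ2 : V → V, IsNE E V1 V2 r1 r2 s σ1 σ2 := by
  obtain ⟨f, hf, h1, h2⟩ := exists_stable E V1 V2 s r1 r2 hpart hdisj
    (fun u x h => (hpos u x h).1) (fun u x h => (hpos u x h).2)
  have hff : nextFun V1 f f = f := by
    funext u
    simp [nextFun]
  have hV : ∀ u ∈ V2, u ∉ V1 := fun u hu h => Set.disjoint_left.1 hdisj h hu
  refine ⟨f, f, fun u hu => hf u ((hpart u).2 (Or.inl hu)),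
    fun u hu => hf u ((hpart u).2 (Or.inr hu)), fun σ hσ => ?_, fun σ hσ => ?_⟩
  · rw [hff]
    refine h1 _ (fun u hu => ?_) fun u hu => ?_
    · simpa [nextFun, hu] using hσ u hu
    · simp [nextFun, hV u hu]
  · rw [hff]
    refine h2 _ (fun u hu => ?_) fun u hu => ?_
    · simpa [nextFun, hV u hu] using hσ u hu
    · simp [nextFun, hu]
end

section
/- Consider a positive two-person shortest-path game on a countably infinite directed graph in which every vertex has finite out-degree. For each n, let Γⁿ be the finite truncated game on the first n vertices (with all further vertices treated as terminals), and suppose each Γⁿ has a Nash equilibrium in pure stationary strategies. Then the infinite game has a Nash equilibrium in pure stationary strategies. (Compactness/diagonal argument: one can choose a strategy pair for the infinite game whose restriction to each Γᵐ agrees with the restriction of a Nash equilibrium of Γⁿ for infinitely many n, and any such pair is a Nash equilibrium of the infinite game.) -/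
open scoped Classical
open scoped Classical

variable {V : Type*}

/-- The cost of the play from `s` in an infinite game: the sum of the local costs up to
termination if the play reaches a terminal, and the limit (supremum) of the partial sums
otherwise (infinite plays may have finite total cost). -/
noncomputable def playCostInf (E : V → V → Prop) (r : V → V → ℝ) (f : V → V) (s : V) :
    EReal :=
  if h : ∃ n, IsTerm E (f^[n] s) then
    (((Finset.range (Nat.find h)).sum fun i => r (f^[i] s) (f^[i + 1] s) : ℝ) : EReal)
  else ⨆ n : ℕ, (((Finset.range n).sum fun i => r (f^[i] s) (f^[i + 1] s) : ℝ) : EReal)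

/-- Nash equilibrium of the infinite game (with costs of infinite plays given by limits
of partial sums). -/
def IsNEInf (E : V → V → Prop) (V1 V2 : Set V) (r1 r2 : V → V → ℝ) (s : V)
    (σ1 σ2 : V → V) : Prop :=
  (∀ u ∈ V1, E u (σ1 u)) ∧ (∀ u ∈ V2, E u (σ2 u)) ∧
  (∀ σ1', (∀ u ∈ V1, E u (σ1' u)) →
    playCostInf E r1 (nextFun V1 σ1 σ2) s ≤ playCostInf E r1 (nextFun V1 σ1' σ2) s) ∧
  (∀ σ2', (∀ u ∈ V2, E u (σ2' u)) →
    playCostInf E r2 (nextFun V1 σ1 σ2) s ≤ playCostInf E r2 (nextFun V1 σ1 σ2') s)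

open scoped ENNReal

/-- The data of a cost game seen by one player, the owner of the vertices in `X`, who pays `ρ`. -/
structure IsArena (E : ℕ → ℕ → Prop) (X : Set ℕ) (ρ : ℕ → ℕ → ℝ≥0∞) : Prop where
  finite_succ : ∀ u, {w | E u w}.Finite
  exists_succ : ∀ u ∈ X, ∃ w, E u w
  pos : ∀ u w, E u w → 0 < ρ u w
  ne_top : ∀ u w, E u w → ρ u w ≠ ⊤

/-- The least cost that the owner of `X` pays in `k` moves along arcs of `H`, when all other
vertices belong to an opponent maximizing this cost. -/
noncomputable def stepVal (H : ℕ → ℕ → Prop) (X : Set ℕ) (ρ : ℕ → ℕ → ℝ≥0∞) : ℕ → ℕ → ℝ≥0∞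
  | 0, _ => 0
  | k + 1, u => if u ∈ X then ⨅ w, ⨅ _ : H u w, ρ u w + stepVal H X ρ k w
      else ⨆ w, ⨆ _ : H u w, ρ u w + stepVal H X ρ k w

/-- The supremum of the finite horizon values. -/
noncomputable def limVal (H : ℕ → ℕ → Prop) (X : Set ℕ) (ρ : ℕ → ℕ → ℝ≥0∞) (u : ℕ) : ℝ≥0∞ :=
  ⨆ k, stepVal H X ρ k u

section Values

variable {H : ℕ → ℕ → Prop} {X : Set ℕ} {ρ : ℕ → ℕ → ℝ≥0∞}

lemma stepVal_succ_le {u w : ℕ} (k : ℕ) (hu : u ∈ X) (h : H u w) :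
    stepVal H X ρ (k + 1) u ≤ ρ u w + stepVal H X ρ k w := by
  simp only [stepVal, hu, if_true]
  exact iInf₂_le w h

lemma le_stepVal_succ {u w : ℕ} (k : ℕ) (hu : u ∉ X) (h : H u w) :
    ρ u w + stepVal H X ρ k w ≤ stepVal H X ρ (k + 1) u := by
  simp only [stepVal, hu, if_false]
  exact le_iSup₂ (f := fun w (_ : H u w) => ρ u w + stepVal H X ρ k w) w h

lemma exists_stepVal_succ_eq {u : ℕ} (k : ℕ) (hfin : {w | H u w}.Finite) (hne : ∃ w, H u w) :
    ∃ w, H u w ∧ stepVal H X ρ (k + 1) u = ρ u w + stepVal H X ρ k w := by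
  by_cases hu : u ∈ X
  · obtain ⟨w, hw, hmin⟩ := Set.exists_min_image {w | H u w}
      (fun w => ρ u w + stepVal H X ρ k w) hfin hne
    refine ⟨w, hw, le_antisymm (stepVal_succ_le k hu hw) ?_⟩
    simp only [stepVal, hu, if_true]
    exact le_iInf₂ hmin
  · obtain ⟨w, hw, hmax⟩ := Set.exists_max_image {w | H u w}
      (fun w => ρ u w + stepVal H X ρ k w) hfin hne
    refine ⟨w, hw, le_antisymm ?_ (le_stepVal_succ k hu hw)⟩
    simp only [stepVal, hu, if_false]
    exact iSup₂_le hmax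

lemma stepVal_le_succ (k : ℕ) : ∀ u, stepVal H X ρ k u ≤ stepVal H X ρ (k + 1) u := by
  induction k with
  | zero => intro u; simp [stepVal]
  | succ k ih =>
    intro u
    by_cases hu : u ∈ X
    · rw [stepVal, stepVal, if_pos hu, if_pos hu]
      exact iInf₂_mono fun w _ => add_le_add le_rfl (ih w)
    · rw [stepVal, stepVal, if_neg hu, if_neg hu]
      exact iSup₂_mono fun w _ => add_le_add le_rfl (ih w)

lemma stepVal_mono (u : ℕ) : Monotone fun k => stepVal H X ρ k u :=
  monotone_nat_of_le_succ fun k => stepVal_le_succ k u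

lemma stepVal_le_limVal (k u : ℕ) : stepVal H X ρ k u ≤ limVal H X ρ u :=
  le_iSup (fun k => stepVal H X ρ k u) k

lemma stepVal_eq_zero {u : ℕ} (k : ℕ) (hu : u ∉ X) (h : ∀ w, ¬ H u w) :
    stepVal H X ρ k u = 0 := by
  cases k with
  | zero => rfl
  | succ k => simp [stepVal, hu, h]

lemma limVal_le {u w : ℕ} (hu : u ∈ X) (h : H u w) :
    limVal H X ρ u ≤ ρ u w + limVal H X ρ w := by
  refine iSup_le fun k => (stepVal_le_succ k u).trans ((stepVal_succ_le k hu h).trans ?_)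
  gcongr
  exact stepVal_le_limVal k w

lemma le_limVal {u w : ℕ} (hu : u ∉ X) (h : H u w) :
    ρ u w + limVal H X ρ w ≤ limVal H X ρ u := by
  rw [limVal, ENNReal.add_iSup]
  exact iSup_le fun k => (le_stepVal_succ k hu h).trans (stepVal_le_limVal (k + 1) u)

lemma exists_limVal_eq {u : ℕ} (hfin : {w | H u w}.Finite) (hne : ∃ w, H u w) :
    ∃ w, H u w ∧ limVal H X ρ u = ρ u w + limVal H X ρ w := by
  by_cases hu : u ∈ X
  · by_contra! hcon
    have hlt : ∀ w, ∃ k, H u w → limVal H X ρ u < ρ u w + stepVal H X ρ k w := by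
      intro w
      by_cases hw : H u w
      · have h1 := lt_of_le_of_ne (limVal_le (ρ := ρ) hu hw) (hcon w hw)
        nth_rewrite 2 [limVal] at h1
        rw [ENNReal.add_iSup] at h1
        obtain ⟨k, hk⟩ := lt_iSup_iff.1 h1
        exact ⟨k, fun _ => hk⟩
      · exact ⟨0, fun h => absurd h hw⟩
    choose k hk using hlt
    obtain ⟨K, hK⟩ := (hfin.image k).bddAbove
    obtain ⟨w, hw, he⟩ := exists_stepVal_succ_eq (X := X) (ρ := ρ) K hfin hne
    have h1 := hk w hw
    have h2 : stepVal H X ρ (k w) w ≤ stepVal H X ρ K w :=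
      stepVal_mono w (hK (Set.mem_image_of_mem k hw))
    have h3 := stepVal_le_limVal (H := H) (X := X) (ρ := ρ) (K + 1) u
    rw [he] at h3
    exact absurd (h1.trans_le ((add_le_add le_rfl h2).trans h3)) (lt_irrefl _)
  · obtain ⟨w, hw, hmax⟩ := Set.exists_max_image {w | H u w}
      (fun w => ρ u w + limVal H X ρ w) hfin hne
    refine ⟨w, hw, le_antisymm ?_ (le_limVal hu hw)⟩
    refine iSup_le fun k => (stepVal_le_succ k u).trans ?_
    obtain ⟨w', hw', he⟩ := exists_stepVal_succ_eq (X := X) (ρ := ρ) k hfin hne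
    rw [he]
    refine le_trans ?_ (hmax w' hw')
    gcongr
    exact stepVal_le_limVal k w'

end Values

/-- Transfinite refinement of the arcs: at each stage only the arcs which are optimal for their
owner with respect to the values of all previous stages survive. -/
noncomputable def optArcs (E : ℕ → ℕ → Prop) (X : Set ℕ) (ρ : ℕ → ℕ → ℝ≥0∞)
    (β : Ordinal.{0}) (u w : ℕ) : Prop :=
  E u w ∧ ∀ γ, (_h : γ < β) →
    limVal (optArcs E X ρ γ) X ρ u = ρ u w + limVal (optArcs E X ρ γ) X ρ w
termination_by β

/-- The value of the stage `β` of the refinement. -/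
noncomputable def optVal (E : ℕ → ℕ → Prop) (X : Set ℕ) (ρ : ℕ → ℕ → ℝ≥0∞)
    (β : Ordinal.{0}) (u : ℕ) : ℝ≥0∞ :=
  limVal (optArcs E X ρ β) X ρ u

section Refinement

variable {E : ℕ → ℕ → Prop} {X : Set ℕ} {ρ : ℕ → ℕ → ℝ≥0∞}

lemma optArcs_iff {β : Ordinal.{0}} {u w : ℕ} :
    optArcs E X ρ β u w ↔
      E u w ∧ ∀ γ < β, optVal E X ρ γ u = ρ u w + optVal E X ρ γ w := by
  rw [optArcs]; rfl

lemma optArcs.arc {β : Ordinal.{0}} {u w : ℕ} (h : optArcs E X ρ β u w) : E u w :=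
  (optArcs_iff.1 h).1

lemma optArcs.tight {β γ : Ordinal.{0}} {u w : ℕ} (h : optArcs E X ρ β u w) (hγ : γ < β) :
    optVal E X ρ γ u = ρ u w + optVal E X ρ γ w :=
  (optArcs_iff.1 h).2 γ hγ

lemma optArcs.anti {β γ : Ordinal.{0}} {u w : ℕ} (h : optArcs E X ρ β u w) (hγ : γ ≤ β) :
    optArcs E X ρ γ u w :=
  optArcs_iff.2 ⟨h.arc, fun _ hδ => h.tight (hδ.trans_le hγ)⟩

lemma finite_optArcs (hA : IsArena E X ρ) (β : Ordinal.{0}) (u : ℕ) :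
    {w | optArcs E X ρ β u w}.Finite :=
  (hA.finite_succ u).subset fun _ h => h.arc

/-- An arc which does not survive fails at a least stage. -/
lemma exists_not_tight {β : Ordinal.{0}} {u w : ℕ} (hE : E u w) (h : ¬ optArcs E X ρ β u w) :
    ∃ δ < β, optArcs E X ρ δ u w ∧ optVal E X ρ δ u ≠ ρ u w + optVal E X ρ δ w := by
  rw [optArcs_iff] at h
  push Not at h
  have hex := h hE
  obtain ⟨δ, ⟨hδ, hne⟩, hmin⟩ := WellFounded.has_min (wellFounded_lt (α := Ordinal.{0}))
    {δ | δ < β ∧ optVal E X ρ δ u ≠ ρ u w + optVal E X ρ δ w} hex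
  refine ⟨δ, hδ, optArcs_iff.2 ⟨hE, fun γ hγ => ?_⟩, hne⟩
  by_contra hc
  exact hmin γ ⟨hγ.trans hδ, hc⟩ hγ

lemma exists_lt_of_mem {β : Ordinal.{0}} {u w : ℕ} (hu : u ∈ X) (hE : E u w)
    (h : ¬ optArcs E X ρ β u w) :
    ∃ δ < β, optArcs E X ρ δ u w ∧ optVal E X ρ δ u < ρ u w + optVal E X ρ δ w := by
  obtain ⟨δ, hδ, ho, hne⟩ := exists_not_tight hE h
  exact ⟨δ, hδ, ho, lt_of_le_of_ne (limVal_le hu ho) hne⟩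

lemma exists_gt_of_not_mem {β : Ordinal.{0}} {u w : ℕ} (hu : u ∉ X) (hE : E u w)
    (h : ¬ optArcs E X ρ β u w) :
    ∃ δ < β, optArcs E X ρ δ u w ∧ ρ u w + optVal E X ρ δ w < optVal E X ρ δ u := by
  obtain ⟨δ, hδ, ho, hne⟩ := exists_not_tight hE h
  exact ⟨δ, hδ, ho, lt_of_le_of_ne (le_limVal hu ho) hne.symm⟩

lemma exists_optArcs (hA : IsArena E X ρ) (β : Ordinal.{0}) {u : ℕ} (hu : ∃ w, E u w) :
    ∃ w, optArcs E X ρ β u w := by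
  induction β using WellFoundedLT.induction with
  | ind β ih =>
    by_contra! hcon
    have hlev : ∀ w, ∃ δ, E u w → δ < β ∧ ¬ optVal E X ρ δ u = ρ u w + optVal E X ρ δ w := by
      intro w
      by_cases hw : E u w
      · obtain ⟨δ, hδ, -, hne⟩ := exists_not_tight hw (hcon w)
        exact ⟨δ, fun _ => ⟨hδ, hne⟩⟩
      · exact ⟨0, fun h => absurd h hw⟩
    choose δ hδ using hlev
    obtain ⟨v, hv, hmax⟩ := Set.exists_max_image {w | E u w} δ (hA.finite_succ u) hu
    obtain ⟨w, hw, ht⟩ := exists_limVal_eq (X := X) (ρ := ρ) (finite_optArcs hA (δ v) u)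
      (ih (δ v) (hδ v hv).1)
    refine (hδ w hw.arc).2 ?_
    rcases (hmax w hw.arc).lt_or_eq with h | h
    · exact hw.tight h
    · rw [h]; exact ht

lemma optVal_anti (hA : IsArena E X ρ) {γ β : Ordinal.{0}} (h : γ ≤ β) (u : ℕ) :
    optVal E X ρ β u ≤ optVal E X ρ γ u := by
  rcases h.eq_or_lt with rfl | h
  · rfl
  have key : ∀ k u, stepVal (optArcs E X ρ β) X ρ k u ≤ optVal E X ρ γ u := by
    intro k
    induction k with
    | zero => intro u; simp [stepVal]
    | succ k ih =>
      intro u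
      by_cases hu : ∃ w, E u w
      · obtain ⟨w, hw, he⟩ := exists_stepVal_succ_eq (X := X) (ρ := ρ) k (finite_optArcs hA β u)
          (exists_optArcs hA β hu)
        rw [he, hw.tight h]
        gcongr
        exact ih w
      · rw [stepVal_eq_zero]
        · exact zero_le
        · exact fun hX => hu (hA.exists_succ u hX)
        · exact fun w hw => hu ⟨w, hw.arc⟩
  exact iSup_le fun k => key k u

lemma optVal_pos (hA : IsArena E X ρ) (β : Ordinal.{0}) {u : ℕ} (hu : ∃ w, E u w) :
    0 < optVal E X ρ β u := by
  obtain ⟨w, hw, he⟩ := exists_limVal_eq (X := X) (ρ := ρ) (finite_optArcs hA β u)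
      (exists_optArcs hA β hu)
  rw [optVal, he]
  exact (hA.pos u w hw.arc).trans_le le_self_add

lemma optVal_eq_zero (hA : IsArena E X ρ) (β : Ordinal.{0}) {u : ℕ} (hu : ¬ ∃ w, E u w) :
    optVal E X ρ β u = 0 := by
  rw [optVal, limVal]
  simp only [ENNReal.iSup_eq_zero]
  exact fun k => stepVal_eq_zero k (fun hX => hu (hA.exists_succ u hX)) fun w hw => hu ⟨w, hw.arc⟩

/-- The refinement becomes stationary. -/
lemma exists_stable_s13 (E : ℕ → ℕ → Prop) (X : Set ℕ) (ρ : ℕ → ℕ → ℝ≥0∞) :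
    ∃ Λ : Ordinal.{0}, ∀ u w, optArcs E X ρ Λ u w →
      optVal E X ρ Λ u = ρ u w + optVal E X ρ Λ w := by
  have hni := not_injective_of_ordinal (fun β : Ordinal.{0} => optArcs E X ρ β)
  rw [Function.Injective] at hni
  push Not at hni
  obtain ⟨α, β, he, hne⟩ := hni
  rcases lt_or_gt_of_ne hne with h | h
  · refine ⟨α, fun u w hw => ?_⟩
    have : optArcs E X ρ β u w := by rw [← congrFun (congrFun he u) w]; exact hw
    exact this.tight h
  · refine ⟨β, fun u w hw => ?_⟩
    have : optArcs E X ρ α u w := by rw [congrFun (congrFun he u) w]; exact hw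
    exact this.tight h

lemma optVal_eq_top_of_arc (hA : IsArena E X ρ) {Λ : Ordinal.{0}} {u w : ℕ} (hu : u ∉ X)
    (hE : E u w) (hw : optVal E X ρ Λ w = ⊤) : optVal E X ρ Λ u = ⊤ := by
  have key : ∀ γ ≤ Λ, optVal E X ρ γ u = ⊤ ∧ optVal E X ρ γ w = ⊤ := by
    intro γ
    induction γ using WellFoundedLT.induction with
    | ind γ ih =>
      intro hγ
      have h1 : optVal E X ρ γ w = ⊤ := top_le_iff.1 (hw ▸ optVal_anti hA hγ w)
      have harc : optArcs E X ρ γ u w := optArcs_iff.2 ⟨hE, fun δ hδ => by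
        obtain ⟨h2, h3⟩ := ih δ hδ (hδ.le.trans hγ)
        simp [h2, h3]⟩
      refine ⟨?_, h1⟩
      have h2 : ρ u w + optVal E X ρ γ w ≤ optVal E X ρ γ u := le_limVal hu harc
      simpa [h1] using h2
  exact (key Λ le_rfl).1

lemma optArcs_of_optVal_eq_top (hA : IsArena E X ρ) {Λ : Ordinal.{0}} {u w : ℕ} (hu : u ∈ X)
    (hE : E u w) (htop : optVal E X ρ Λ u = ⊤) :
    optArcs E X ρ Λ u w ∧ optVal E X ρ Λ w = ⊤ := by
  have key : ∀ γ ≤ Λ, optArcs E X ρ γ u w ∧ optVal E X ρ γ u = ⊤ ∧ optVal E X ρ γ w = ⊤ := by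
    intro γ
    induction γ using WellFoundedLT.induction with
    | ind γ ih =>
      intro hγ
      have h1 : optVal E X ρ γ u = ⊤ := top_le_iff.1 (htop ▸ optVal_anti hA hγ u)
      have harc : optArcs E X ρ γ u w := optArcs_iff.2 ⟨hE, fun δ hδ => by
        obtain ⟨-, h2, h3⟩ := ih δ hδ (hδ.le.trans hγ)
        simp [h2, h3]⟩
      refine ⟨harc, h1, ?_⟩
      have h2 : optVal E X ρ γ u ≤ ρ u w + optVal E X ρ γ w := limVal_le hu harc
      rw [h1, top_le_iff, ENNReal.add_eq_top] at h2
      exact h2.resolve_left (hA.ne_top u w hE)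
  exact ⟨(key Λ le_rfl).1, (key Λ le_rfl).2.2⟩

end Refinement

/-- A play, continued by staying forever at a terminal once it is reached. -/
def IsPlay (E : ℕ → ℕ → Prop) (v : ℕ → ℕ) : Prop :=
  ∀ n, E (v n) (v (n + 1)) ∨ IsTerm E (v n) ∧ v (n + 1) = v n

/-- The cost of the first `n` moves of a play. -/
noncomputable def elapsed (E : ℕ → ℕ → Prop) (ρ : ℕ → ℕ → ℝ≥0∞) (v : ℕ → ℕ) (n : ℕ) : ℝ≥0∞ :=
  ∑ i ∈ Finset.range n, if IsTerm E (v i) then 0 else ρ (v i) (v (i + 1))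

/-- The total cost of a play. -/
noncomputable def totalCost (E : ℕ → ℕ → Prop) (ρ : ℕ → ℕ → ℝ≥0∞) (v : ℕ → ℕ) : ℝ≥0∞ :=
  ⨆ n, elapsed E ρ v n

section Plays

variable {E : ℕ → ℕ → Prop} {X : Set ℕ} {ρ : ℕ → ℕ → ℝ≥0∞} {v : ℕ → ℕ}

lemma elapsed_zero : elapsed E ρ v 0 = 0 := by simp [elapsed]

lemma elapsed_succ_of_arc {n w : ℕ} (h : E (v n) w) :
    elapsed E ρ v (n + 1) = elapsed E ρ v n + ρ (v n) (v (n + 1)) := by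
  have hn : ¬ IsTerm E (v n) := fun ht => ht _ h
  simp [elapsed, Finset.sum_range_succ, hn]

lemma elapsed_succ_of_isTerm {n : ℕ} (h : IsTerm E (v n)) :
    elapsed E ρ v (n + 1) = elapsed E ρ v n := by
  simp [elapsed, Finset.sum_range_succ, h]

lemma elapsed_mono : Monotone (elapsed E ρ v) :=
  monotone_nat_of_le_succ fun n => by
    rw [elapsed, elapsed, Finset.sum_range_succ]
    exact le_self_add

lemma elapsed_le_totalCost (n : ℕ) : elapsed E ρ v n ≤ totalCost E ρ v :=
  le_iSup (elapsed E ρ v) n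

lemma elapsed_ne_top (hA : IsArena E X ρ) (hv : IsPlay E v) (n : ℕ) : elapsed E ρ v n ≠ ⊤ := by
  refine ENNReal.sum_ne_top.2 fun i _ => ?_
  split_ifs with h
  · exact ENNReal.zero_ne_top
  · exact hA.ne_top _ _ ((hv i).resolve_right fun h' => h h'.1)

lemma totalCost_eq_elapsed (hv : IsPlay E v) {n : ℕ} (h : IsTerm E (v n)) :
    totalCost E ρ v = elapsed E ρ v n := by
  have key : ∀ m, v (n + m) = v n ∧ elapsed E ρ v (n + m) = elapsed E ρ v n := by
    intro m
    induction m with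
    | zero => exact ⟨rfl, rfl⟩
    | succ m ih =>
      have ht : IsTerm E (v (n + m)) := ih.1.symm ▸ h
      refine ⟨?_, (elapsed_succ_of_isTerm ht).trans ih.2⟩
      rcases hv (n + m) with h' | h'
      · exact absurd h' (ht _)
      · exact h'.2.trans ih.1
  refine le_antisymm (iSup_le fun m => ?_) (elapsed_le_totalCost n)
  exact (elapsed_mono (Nat.le_add_left m n)).trans (key m).2.le

end Plays

/-- A play of finite value in a stationary refinement along which the owner of `X` only uses
surviving arcs. -/
structure IsLeaderPlay (E : ℕ → ℕ → Prop) (X : Set ℕ) (ρ : ℕ → ℕ → ℝ≥0∞) (Λ : Ordinal.{0})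
    (v : ℕ → ℕ) : Prop where
  arena : IsArena E X ρ
  stable : ∀ u w, optArcs E X ρ Λ u w → optVal E X ρ Λ u = ρ u w + optVal E X ρ Λ w
  play : IsPlay E v
  arcs : ∀ n, v n ∈ X → optArcs E X ρ Λ (v n) (v (n + 1))
  start_ne_top : optVal E X ρ Λ (v 0) ≠ ⊤

/-- The `n`th move of a play follows an arc of stage `β`, or the play is over. -/
def Stays (E : ℕ → ℕ → Prop) (X : Set ℕ) (ρ : ℕ → ℕ → ℝ≥0∞) (v : ℕ → ℕ) (β : Ordinal.{0})
    (n : ℕ) : Prop :=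
  IsTerm E (v n) ∨ optArcs E X ρ β (v n) (v (n + 1))

section LeaderPlay

variable {E : ℕ → ℕ → Prop} {X : Set ℕ} {ρ : ℕ → ℕ → ℝ≥0∞} {Λ : Ordinal.{0}} {v : ℕ → ℕ}

lemma Stays.anti {β γ : Ordinal.{0}} {n : ℕ} (h : Stays E X ρ v β n) (hγ : γ ≤ β) :
    Stays E X ρ v γ n :=
  h.imp_right fun h => h.anti hγ

namespace IsLeaderPlay

variable (hP : IsLeaderPlay E X ρ Λ v)

include hP

lemma tight {β : Ordinal.{0}} (hβ : β ≤ Λ) {u w : ℕ} (h : optArcs E X ρ Λ u w) :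
    optVal E X ρ β u = ρ u w + optVal E X ρ β w := by
  rcases hβ.eq_or_lt with rfl | hβ
  · exact hP.stable u w h
  · exact h.tight hβ

lemma optVal_ne_top (n : ℕ) : optVal E X ρ Λ (v n) ≠ ⊤ := by
  induction n with
  | zero => exact hP.start_ne_top
  | succ n ih =>
    rcases hP.play n with h | h
    · intro htop
      by_cases hX : v n ∈ X
      · exact ih (by rw [hP.stable _ _ (hP.arcs n hX), htop, add_top])
      · exact ih (optVal_eq_top_of_arc hP.arena hX h htop)
    · rwa [h.2]

lemma elapsed_add_optVal_succ_le {β : Ordinal.{0}} (hβ : β ≤ Λ) {n : ℕ} (h : Stays E X ρ v β n) :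
    elapsed E ρ v (n + 1) + optVal E X ρ β (v (n + 1)) ≤
      elapsed E ρ v n + optVal E X ρ β (v n) := by
  rcases hP.play n with he | ⟨ht, he⟩
  · have ho := h.resolve_left fun ht => ht _ he
    rw [elapsed_succ_of_arc he, add_assoc]
    gcongr
    by_cases hX : v n ∈ X
    · exact (hP.tight hβ (hP.arcs n hX)).ge
    · exact le_limVal hX ho
  · rw [elapsed_succ_of_isTerm ht, he]

lemma elapsed_add_optVal_le {β : Ordinal.{0}} (hβ : β ≤ Λ) {q j : ℕ} (hqj : q ≤ j)
    (h : ∀ m, q ≤ m → m < j → Stays E X ρ v β m) :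
    elapsed E ρ v j + optVal E X ρ β (v j) ≤ elapsed E ρ v q + optVal E X ρ β (v q) := by
  induction j, hqj using Nat.le_induction with
  | base => rfl
  | succ j hqj ih =>
    exact (hP.elapsed_add_optVal_succ_le hβ (h j hqj j.lt_succ_self)).trans
      (ih fun m h1 h2 => h m h1 (h2.trans j.lt_succ_self))

/-- A move that leaves a stage is a gift of the opponent at some lower stage. -/
lemma exists_gift {β : Ordinal.{0}} (hβ : β ≤ Λ) {n : ℕ} (h : ¬ Stays E X ρ v β n) :
    E (v n) (v (n + 1)) ∧ ∃ δ < β, optArcs E X ρ δ (v n) (v (n + 1)) ∧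
      ρ (v n) (v (n + 1)) + optVal E X ρ δ (v (n + 1)) < optVal E X ρ δ (v n) := by
  rw [Stays, not_or] at h
  have he := (hP.play n).resolve_right fun h' => h.1 h'.1
  refine ⟨he, exists_gt_of_not_mem (fun hX => h.2 ((hP.arcs n hX).anti hβ)) he h.2⟩

/-- Comparing a deviation with the play up to stage `β` shows that the deviation does not
return to the play earlier than the play itself. -/
lemma elapsed_le {β : Ordinal.{0}} (hβ : β ≤ Λ) {q j : ℕ} (hqj : q ≤ j) {d : ℝ≥0∞}
    (h : ∀ δ ≤ β, elapsed E ρ v q + optVal E X ρ δ (v q) ≤ d + optVal E X ρ δ (v j))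
    (hne : optVal E X ρ β (v q) ≠ ⊤) : elapsed E ρ v j ≤ d := by
  have hel := fun n => elapsed_ne_top hP.arena hP.play n
  by_cases hall : ∀ m, q ≤ m → m < j → Stays E X ρ v β m
  · have h1 := hP.elapsed_add_optVal_le hβ hqj hall
    have h2 : optVal E X ρ β (v j) ≠ ⊤ := fun ht => by
      rw [ht, add_top, top_le_iff, ENNReal.add_eq_top] at h1
      exact h1.elim (hel q) hne
    exact (ENNReal.add_le_add_iff_right h2).1 (h1.trans (h β le_rfl))
  · push Not at hall
    have hex : ∃ δ < β, ∃ m, q ≤ m ∧ m < j ∧ E (v m) (v (m + 1)) ∧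
        ρ (v m) (v (m + 1)) + optVal E X ρ δ (v (m + 1)) < optVal E X ρ δ (v m) := by
      obtain ⟨m, h1, h2, h3⟩ := hall
      obtain ⟨he, δ, hδ, -, hlt⟩ := hP.exists_gift hβ h3
      exact ⟨δ, hδ, m, h1, h2, he, hlt⟩
    obtain ⟨δ, ⟨hδ, m, hqm, hmj, he, hlt⟩, hmin⟩ :=
      WellFounded.has_min (wellFounded_lt (α := Ordinal.{0})) {δ | δ < β ∧ _} hex
    have hst : ∀ i, q ≤ i → i < j → Stays E X ρ v δ i := by
      intro i h1 h2
      by_contra hc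
      obtain ⟨he', γ, hγ, -, hlt'⟩ := hP.exists_gift (hδ.le.trans hβ) hc
      exact hmin γ ⟨hγ.trans hδ, i, h1, h2, he', hlt'⟩ hγ
    have hδΛ := hδ.le.trans hβ
    have h1 := hP.elapsed_add_optVal_le hδΛ hmj
      fun i h1 h2 => hst i (hqm.trans (Nat.le_of_succ_le h1)) h2
    have h2 : optVal E X ρ δ (v j) ≠ ⊤ := fun ht => by
      rw [ht, add_top, top_le_iff, ENNReal.add_eq_top] at h1
      refine h1.elim (hel _) fun ht' => ?_
      rw [ht', add_top] at hlt
      exact not_top_lt hlt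
    exact (ENNReal.add_le_add_iff_right h2).1
      ((hP.elapsed_add_optVal_le hδΛ hqj hst).trans (h δ hδ.le))

end IsLeaderPlay

end LeaderPlay

/-- The opponent of the owner of `X` can force the play from `u`, entered after paying `d`, to
reach `leaf` in boundedly many moves, while `ok` holds along the way. -/
inductive Force (E : ℕ → ℕ → Prop) (X : Set ℕ) (ρ : ℕ → ℕ → ℝ≥0∞) (ok leaf : ℕ → ℝ≥0∞ → Prop) :
    ℕ → ℝ≥0∞ → Prop
  | leaf (u : ℕ) (d : ℝ≥0∞) : ok u d → leaf u d → Force E X ρ ok leaf u d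
  | all (u : ℕ) (d : ℝ≥0∞) : u ∈ X → ok u d →
      (∀ w, E u w → Force E X ρ ok leaf w (d + ρ u w)) → Force E X ρ ok leaf u d
  | some (u w : ℕ) (d : ℝ≥0∞) : u ∉ X → ok u d → E u w →
      Force E X ρ ok leaf w (d + ρ u w) → Force E X ρ ok leaf u d

/-- The vertex `u` is not reached at cost `d` before the play `v` first visits it. -/
def OnTime (E : ℕ → ℕ → Prop) (ρ : ℕ → ℕ → ℝ≥0∞) (v : ℕ → ℕ) (u : ℕ) (d : ℝ≥0∞) : Prop :=
  ∀ j, v j = u → ∃ i, v i = u ∧ elapsed E ρ v i ≤ d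

/-- At `u`, entered after paying `d`, the owner of `X` is not better off than at the `q`th vertex
of the play `v`, for all stages up to `Λ`. -/
def NotAhead (E : ℕ → ℕ → Prop) (X : Set ℕ) (ρ : ℕ → ℕ → ℝ≥0∞) (Λ : Ordinal.{0}) (v : ℕ → ℕ)
    (q u : ℕ) (d : ℝ≥0∞) : Prop :=
  (∀ j < q, elapsed E ρ v j ≤ d) ∧
    ∀ δ ≤ Λ, elapsed E ρ v q + optVal E X ρ δ (v q) ≤ d + optVal E X ρ δ u

/-- The states from which the opponent never ends a deviation at a cost below that of `v`. -/
def Deterred (E : ℕ → ℕ → Prop) (X : Set ℕ) (ρ : ℕ → ℕ → ℝ≥0∞) (Λ : Ordinal.{0}) (v : ℕ → ℕ)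
    (u : ℕ) (d : ℝ≥0∞) : Prop :=
  d ≠ ⊤ ∧ ∃ q, NotAhead E X ρ Λ v q u d ∧ ∀ m, q ≤ m → Stays E X ρ v Λ m

section Forcing

variable {E : ℕ → ℕ → Prop} {X : Set ℕ} {ρ : ℕ → ℕ → ℝ≥0∞} {Λ : Ordinal.{0}} {v : ℕ → ℕ}

lemma Force.imp {ok leaf leaf' : ℕ → ℝ≥0∞ → Prop} (h : ∀ u d, leaf u d → leaf' u d) {u : ℕ}
    {d : ℝ≥0∞} (hF : Force E X ρ ok leaf u d) : Force E X ρ ok leaf' u d := by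
  induction hF with
  | leaf u d ho hl => exact .leaf u d ho (h u d hl)
  | all u d hX ho _ ih => exact .all u d hX ho ih
  | some u w d hX ho he _ ih => exact .some u w d hX ho he ih

lemma exists_lt_add_stepVal {β : Ordinal.{0}} {a d : ℝ≥0∞} {u : ℕ}
    (h : a < d + optVal E X ρ β u) : ∃ k, a < d + stepVal (optArcs E X ρ β) X ρ k u := by
  rw [optVal, limVal, ENNReal.add_iSup] at h
  exact lt_iSup_iff.1 h

namespace IsLeaderPlay

variable (hP : IsLeaderPlay E X ρ Λ v)

include hP

/-- The first gift of the opponent after time `q` outside stage `β`. -/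
lemma exists_first_gift {β : Ordinal.{0}} (hβ : β ≤ Λ) {q : ℕ}
    (h : ¬ ∀ m, q ≤ m → Stays E X ρ v β m) :
    ∃ B, q ≤ B ∧ (∀ m, q ≤ m → m < B → Stays E X ρ v β m) ∧ (∃ w, E (v B) w) ∧ ∃ δ < β,
      (∀ γ ≤ δ, elapsed E ρ v (B + 1) + optVal E X ρ γ (v (B + 1)) ≤
        elapsed E ρ v q + optVal E X ρ γ (v q)) ∧
      elapsed E ρ v (B + 1) + optVal E X ρ δ (v (B + 1)) <
        elapsed E ρ v q + optVal E X ρ δ (v q) := by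
  push Not at h
  classical
  set B := Nat.find h
  obtain ⟨hqB, hB⟩ := Nat.find_spec h
  have hst : ∀ m, q ≤ m → m < B → Stays E X ρ v β m := fun m h1 h2 => by
    by_contra hc
    exact Nat.find_min h h2 ⟨h1, hc⟩
  obtain ⟨he, δ, hδ, ho, hlt⟩ := hP.exists_gift hβ hB
  refine ⟨B, hqB, hst, ⟨_, he⟩, δ, hδ, fun γ hγ => ?_, ?_⟩
  · refine hP.elapsed_add_optVal_le (hγ.trans (hδ.le.trans hβ)) (Nat.le_succ_of_le hqB)
      fun m h1 h2 => ?_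
    rcases (Nat.le_of_lt_succ h2).eq_or_lt with rfl | h2
    · exact Or.inr (ho.anti hγ)
    · exact (hst m h1 h2).anti (hγ.trans hδ.le)
  · refine lt_of_lt_of_le ?_ (hP.elapsed_add_optVal_le (hδ.le.trans hβ) hqB
      fun m h1 h2 => (hst m h1 h2).anti hδ.le)
    rw [elapsed_succ_of_arc he, add_assoc]
    exact (ENNReal.add_lt_add_iff_left (elapsed_ne_top hP.arena hP.play _)).2 hlt

lemma onTime {β : Ordinal.{0}} (hβ : β ≤ Λ) {q u : ℕ} {d : ℝ≥0∞}
    (h1 : ∀ j < q, elapsed E ρ v j ≤ d)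
    (h2 : ∀ δ ≤ β, elapsed E ρ v q + optVal E X ρ δ (v q) ≤ d + optVal E X ρ δ u)
    (hne : optVal E X ρ β (v q) ≠ ⊤) : OnTime E ρ v u d := by
  intro j hj
  refine ⟨j, hj, ?_⟩
  rcases lt_or_ge j q with h | h
  · exact h1 j h
  · exact hP.elapsed_le hβ h (fun δ hδ => by rw [hj]; exact h2 δ hδ) hne

lemma elapsed_le_of_stays {β : Ordinal.{0}} (hβ : β ≤ Λ) {q B : ℕ} {d : ℝ≥0∞} (hqB : q ≤ B)
    (h2 : elapsed E ρ v q + optVal E X ρ β (v q) ≤ d)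
    (hst : ∀ m, q ≤ m → m < B → Stays E X ρ v β m) : elapsed E ρ v B ≤ d :=
  le_self_add.trans ((hP.elapsed_add_optVal_le hβ hqB hst).trans h2)

lemma totalCost_le_of_stays {β : Ordinal.{0}} (hβ : β ≤ Λ) {q : ℕ}
    (hst : ∀ m, q ≤ m → Stays E X ρ v β m) :
    totalCost E ρ v ≤ elapsed E ρ v q + optVal E X ρ β (v q) := by
  refine iSup_le fun j => ?_
  rcases le_total q j with h | h
  · exact hP.elapsed_le_of_stays hβ h le_rfl fun m h1 _ => hst m h1
  · exact (elapsed_mono h).trans le_self_add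

lemma force_of_lt_stepVal {β : Ordinal.{0}} (hβ : β ≤ Λ) (q : ℕ) :
    ∀ (k u : ℕ) (d : ℝ≥0∞), d ≠ ⊤ → (∀ j < q, elapsed E ρ v j ≤ d) →
      elapsed E ρ v q + optVal E X ρ β (v q) < d + stepVal (optArcs E X ρ β) X ρ k u →
      (∀ δ < β, elapsed E ρ v q + optVal E X ρ δ (v q) ≤ d + optVal E X ρ δ u) →
      Force E X ρ (OnTime E ρ v) (fun _ d => totalCost E ρ v ≤ d) u d := by
  have hA := hP.arena
  induction β using WellFoundedLT.induction generalizing q with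
  | ind β ih =>
  have ihval : ∀ δ < β, ∀ (q u : ℕ) (d : ℝ≥0∞), d ≠ ⊤ → (∀ j < q, elapsed E ρ v j ≤ d) →
      elapsed E ρ v q + optVal E X ρ δ (v q) < d + optVal E X ρ δ u →
      (∀ γ < δ, elapsed E ρ v q + optVal E X ρ γ (v q) ≤ d + optVal E X ρ γ u) →
      Force E X ρ (OnTime E ρ v) (fun _ d => totalCost E ρ v ≤ d) u d := by
    intro δ hδ q u d hd ha hb hc
    obtain ⟨k, hk⟩ := exists_lt_add_stepVal hb
    exact ih δ hδ (hδ.le.trans hβ) q k u d hd ha hk hc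
  intro k
  have hok : ∀ (k u : ℕ) (d : ℝ≥0∞), (∀ j < q, elapsed E ρ v j ≤ d) →
      elapsed E ρ v q + optVal E X ρ β (v q) < d + stepVal (optArcs E X ρ β) X ρ k u →
      (∀ δ < β, elapsed E ρ v q + optVal E X ρ δ (v q) ≤ d + optVal E X ρ δ u) →
      OnTime E ρ v u d := by
    intro k u d ha hb hc
    refine hP.onTime hβ ha (fun δ hδ => ?_) fun ht => ?_
    · rcases hδ.eq_or_lt with rfl | hδ
      · exact hb.le.trans (add_le_add le_rfl (stepVal_le_limVal k u))
      · exact hc δ hδ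
    · rw [ht, add_top] at hb
      exact not_top_lt hb
  have hend : ∀ (u : ℕ) (d : ℝ≥0∞), d ≠ ⊤ → OnTime E ρ v u d → (∀ j < q, elapsed E ρ v j ≤ d) →
      elapsed E ρ v q + optVal E X ρ β (v q) < d →
      (∀ δ < β, elapsed E ρ v q + optVal E X ρ δ (v q) ≤ d + optVal E X ρ δ u) →
      Force E X ρ (OnTime E ρ v) (fun _ d => totalCost E ρ v ≤ d) u d := by
    intro u d hd ho ha hb hc
    by_cases hall : ∀ m, q ≤ m → Stays E X ρ v β m
    · exact .leaf u d ho ((hP.totalCost_le_of_stays hβ hall).trans hb.le)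
    · obtain ⟨B, hqB, hst, -, δ, hδ, h1, h2⟩ := hP.exists_first_gift hβ hall
      refine ihval δ hδ (B + 1) u d hd (fun j hj => ?_) (h2.trans_le (hc δ hδ))
        fun γ hγ => (h1 γ hγ.le).trans (hc γ (hγ.trans hδ))
      exact (elapsed_mono (Nat.le_of_lt_succ hj)).trans
        (hP.elapsed_le_of_stays hβ hqB hb.le hst)
  induction k with
  | zero =>
    intro u d hd ha hb hc
    exact hend u d hd (hok 0 u d ha hb hc) ha (by simpa [stepVal] using hb) hc
  | succ k ihk =>
    intro u d hd ha hb hc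
    have ho := hok (k + 1) u d ha hb hc
    by_cases hu : ∃ w, E u w
    · by_cases hX : u ∈ X
      · refine .all u d hX ho fun w hw => ?_
        have hd' : d + ρ u w ≠ ⊤ := ENNReal.add_ne_top.2 ⟨hd, hA.ne_top u w hw⟩
        have ha' : ∀ j < q, elapsed E ρ v j ≤ d + ρ u w :=
          fun j hj => (ha j hj).trans le_self_add
        by_cases hm : optArcs E X ρ β u w
        · refine ihk w (d + ρ u w) hd' ha' ?_ fun δ hδ => ?_
          · rw [add_assoc]
            exact hb.trans_le (add_le_add le_rfl (stepVal_succ_le k hX hm))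
          · rw [add_assoc, ← hm.tight hδ]
            exact hc δ hδ
        · obtain ⟨δ, hδ, hm', hlt⟩ := exists_lt_of_mem hX hw hm
          refine ihval δ hδ q w (d + ρ u w) hd' ha' ?_ fun γ hγ => ?_
          · rw [add_assoc]
            exact (hc δ hδ).trans_lt ((ENNReal.add_lt_add_iff_left hd).2 hlt)
          · rw [add_assoc, ← hm'.tight hγ]
            exact hc γ (hγ.trans hδ)
      · obtain ⟨w, hm, he⟩ := exists_stepVal_succ_eq (X := X) (ρ := ρ) k
          (finite_optArcs hA β u) (exists_optArcs hA β hu)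
        refine .some u w d hX ho hm.arc (ihk w (d + ρ u w)
          (ENNReal.add_ne_top.2 ⟨hd, hA.ne_top u w hm.arc⟩)
          (fun j hj => (ha j hj).trans le_self_add) ?_ fun δ hδ => ?_)
        · rw [add_assoc, ← he]
          exact hb
        · rw [add_assoc, ← hm.tight hδ]
          exact hc δ hδ
    · refine hend u d hd ho ha ?_ hc
      rwa [stepVal_eq_zero _ (fun hX => hu (hA.exists_succ u hX)) fun w hw => hu ⟨w, hw.arc⟩,
        add_zero] at hb

lemma force_of_lt {β : Ordinal.{0}} (hβ : β ≤ Λ) {q u : ℕ} {d : ℝ≥0∞} (hd : d ≠ ⊤)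
    (ha : ∀ j < q, elapsed E ρ v j ≤ d)
    (hb : elapsed E ρ v q + optVal E X ρ β (v q) < d + optVal E X ρ β u)
    (hc : ∀ δ < β, elapsed E ρ v q + optVal E X ρ δ (v q) ≤ d + optVal E X ρ δ u) :
    Force E X ρ (OnTime E ρ v) (fun _ d => totalCost E ρ v ≤ d) u d := by
  obtain ⟨k, hk⟩ := exists_lt_add_stepVal hb
  exact hP.force_of_lt_stepVal hβ q k u d hd ha hk hc

lemma force_of_leaving {q u w : ℕ} {d : ℝ≥0∞} (hd : d ≠ ⊤) (hX : u ∈ X) (hw : E u w)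
    (hm : ¬ optArcs E X ρ Λ u w) (h : NotAhead E X ρ Λ v q u d) :
    Force E X ρ (OnTime E ρ v) (fun _ d => totalCost E ρ v ≤ d) w (d + ρ u w) := by
  obtain ⟨δ, hδ, hm', hlt⟩ := exists_lt_of_mem hX hw hm
  refine hP.force_of_lt hδ.le (ENNReal.add_ne_top.2 ⟨hd, hP.arena.ne_top u w hw⟩)
    (fun j hj => (h.1 j hj).trans le_self_add) ?_ fun γ hγ => ?_
  · rw [add_assoc]
    exact (h.2 δ hδ.le).trans_lt ((ENNReal.add_lt_add_iff_left hd).2 hlt)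
  · rw [add_assoc, ← hm'.tight hγ]
    exact h.2 γ (hγ.le.trans hδ.le)

lemma notAhead_of_arc {q u w : ℕ} {d : ℝ≥0∞} (hm : optArcs E X ρ Λ u w)
    (h : NotAhead E X ρ Λ v q u d) : NotAhead E X ρ Λ v q w (d + ρ u w) := by
  refine ⟨fun j hj => (h.1 j hj).trans le_self_add, fun δ hδ => ?_⟩
  rw [add_assoc, ← hP.tight hδ hm]
  exact h.2 δ hδ

lemma onTime_of_notAhead {q u : ℕ} {d : ℝ≥0∞} (h : NotAhead E X ρ Λ v q u d) :
    OnTime E ρ v u d :=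
  hP.onTime le_rfl h.1 h.2 (hP.optVal_ne_top q)

lemma force_of_notAhead_aux {leaf : ℕ → ℝ≥0∞ → Prop} {θ : ℝ≥0∞} {q : ℕ}
    (hleaf : ∀ u d, totalCost E ρ v ≤ d → leaf u d)
    (hend : ∀ u d, d ≠ ⊤ → NotAhead E X ρ Λ v q u d → θ < d →
      Force E X ρ (OnTime E ρ v) leaf u d) :
    ∀ (k u : ℕ) (d : ℝ≥0∞), d ≠ ⊤ → NotAhead E X ρ Λ v q u d →
      θ < d + stepVal (optArcs E X ρ Λ) X ρ k u → Force E X ρ (OnTime E ρ v) leaf u d := by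
  have hA := hP.arena
  intro k
  induction k with
  | zero =>
    intro u d hd h hθ
    exact hend u d hd h (by simpa [stepVal] using hθ)
  | succ k ihk =>
    intro u d hd h hθ
    have ho := hP.onTime_of_notAhead h
    by_cases hu : ∃ w, E u w
    · by_cases hX : u ∈ X
      · refine .all u d hX ho fun w hw => ?_
        by_cases hm : optArcs E X ρ Λ u w
        · refine ihk w (d + ρ u w) (ENNReal.add_ne_top.2 ⟨hd, hA.ne_top u w hw⟩)
            (hP.notAhead_of_arc hm h) ?_
          rw [add_assoc]
          exact hθ.trans_le (add_le_add le_rfl (stepVal_succ_le k hX hm))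
        · exact (hP.force_of_leaving hd hX hw hm h).imp hleaf
      · obtain ⟨w, hm, he⟩ := exists_stepVal_succ_eq (X := X) (ρ := ρ) k
          (finite_optArcs hA Λ u) (exists_optArcs hA Λ hu)
        refine .some u w d hX ho hm.arc (ihk w (d + ρ u w)
          (ENNReal.add_ne_top.2 ⟨hd, hA.ne_top u w hm.arc⟩) (hP.notAhead_of_arc hm h) ?_)
        rw [add_assoc, ← he]
        exact hθ
    · refine hend u d hd h ?_
      rwa [stepVal_eq_zero _ (fun hX => hu (hA.exists_succ u hX)) fun w hw => hu ⟨w, hw.arc⟩,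
        add_zero] at hθ

lemma force_of_notAhead {q u : ℕ} {d y : ℝ≥0∞} (hd : d ≠ ⊤) (h : NotAhead E X ρ Λ v q u d)
    (hy : y < totalCost E ρ v) :
    Force E X ρ (OnTime E ρ v)
      (fun u d => totalCost E ρ v ≤ d ∨ y ≤ d ∧ Deterred E X ρ Λ v u d) u d := by
  by_cases hall : ∀ m, q ≤ m → Stays E X ρ v Λ m
  · have hlt : y < d + optVal E X ρ Λ u :=
      hy.trans_le ((hP.totalCost_le_of_stays le_rfl hall).trans (h.2 Λ le_rfl))
    obtain ⟨k, hk⟩ := exists_lt_add_stepVal hlt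
    refine hP.force_of_notAhead_aux (fun _ _ h => Or.inl h) (fun u d hd h hyd => ?_) k u d hd h hk
    exact .leaf u d (hP.onTime_of_notAhead h) (Or.inr ⟨hyd.le, hd, q, h, hall⟩)
  · obtain ⟨B, hqB, hst, hnt, δ, hδ, h1, h2⟩ := hP.exists_first_gift le_rfl hall
    have hlt : elapsed E ρ v B < d + optVal E X ρ Λ u :=
      ((ENNReal.lt_add_right (elapsed_ne_top hP.arena hP.play B)
        (optVal_pos hP.arena Λ hnt).ne').trans_le
        (hP.elapsed_add_optVal_le le_rfl hqB hst)).trans_le (h.2 Λ le_rfl)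
    obtain ⟨k, hk⟩ := exists_lt_add_stepVal hlt
    refine hP.force_of_notAhead_aux (fun _ _ h => Or.inl h) (fun u d hd h hBd => ?_) k u d hd h hk
    refine (hP.force_of_lt hδ.le hd (fun j hj => ?_) (h2.trans_le (h.2 δ hδ.le))
      fun γ hγ => (h1 γ hγ.le).trans (h.2 γ (hγ.le.trans hδ.le))).imp fun _ _ h => Or.inl h
    exact (elapsed_mono (Nat.le_of_lt_succ hj)).trans hBd.le

/-- Every deviation of the owner of `X` from the play can be answered. -/
lemma force_of_deviation {i w : ℕ} {y : ℝ≥0∞} (hX : v i ∈ X) (hw : E (v i) w)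
    (hy : y < totalCost E ρ v) :
    Force E X ρ (OnTime E ρ v)
      (fun u d => totalCost E ρ v ≤ d ∨ y ≤ d ∧ Deterred E X ρ Λ v u d) w
      (elapsed E ρ v i + ρ (v i) w) := by
  have hi := elapsed_ne_top hP.arena hP.play i
  have h0 : NotAhead E X ρ Λ v i (v i) (elapsed E ρ v i) :=
    ⟨fun j hj => elapsed_mono hj.le, fun δ _ => le_rfl⟩
  by_cases hm : optArcs E X ρ Λ (v i) w
  · exact hP.force_of_notAhead (ENNReal.add_ne_top.2 ⟨hi, hP.arena.ne_top _ w hw⟩)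
      (hP.notAhead_of_arc hm h0) hy
  · exact (hP.force_of_leaving hi hX hw hm h0).imp fun _ _ h => Or.inl h

end IsLeaderPlay

end Forcing

/-- The set `N` of states `(vertex, cost paid so far)` lets the opponent of the owner of `X`
continue from `z` within `N`. -/
def ClosedAt (E : ℕ → ℕ → Prop) (X : Set ℕ) (ρ : ℕ → ℕ → ℝ≥0∞) (N : Set (ℕ × ℝ≥0∞))
    (z : ℕ × ℝ≥0∞) : Prop :=
  (z.1 ∈ X → ∀ w, E z.1 w → (w, z.2 + ρ z.1 w) ∈ N) ∧
    (z.1 ∉ X → ∃ w, E z.1 w ∧ (w, z.2 + ρ z.1 w) ∈ N)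

section States

variable {E : ℕ → ℕ → Prop} {X : Set ℕ} {ρ : ℕ → ℕ → ℝ≥0∞}

lemma ClosedAt.mono {N N' : Set (ℕ × ℝ≥0∞)} {z : ℕ × ℝ≥0∞} (h : ClosedAt E X ρ N z)
    (hN : N ⊆ N') : ClosedAt E X ρ N' z :=
  ⟨fun hX w hw => hN (h.1 hX w hw), fun hX => (h.2 hX).imp fun _ hw => ⟨hw.1, hN hw.2⟩⟩

lemma Force.exists_finite (hA : IsArena E X ρ) {ok leaf : ℕ → ℝ≥0∞ → Prop} {u : ℕ} {d : ℝ≥0∞}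
    (hF : Force E X ρ ok leaf u d) :
    ∃ N : Set (ℕ × ℝ≥0∞), N.Finite ∧ (u, d) ∈ N ∧
      ∀ z ∈ N, d ≤ z.2 ∧ ok z.1 z.2 ∧ (leaf z.1 z.2 ∨ ClosedAt E X ρ N z) := by
  induction hF with
  | leaf u d ho hl =>
    refine ⟨{(u, d)}, Set.finite_singleton _, rfl, ?_⟩
    rintro z rfl
    exact ⟨le_rfl, ho, Or.inl hl⟩
  | all u d hX ho _ ih =>
    choose! N hfin hmem hN using ih
    refine ⟨{(u, d)} ∪ ⋃ w ∈ {w | E u w}, N w,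
      (Set.finite_singleton _).union ((hA.finite_succ u).biUnion fun w hw => hfin w hw),
      Or.inl rfl, ?_⟩
    have hsub : ∀ w, E u w → N w ⊆ {(u, d)} ∪ ⋃ w ∈ {w | E u w}, N w :=
      fun w hw z hz => Or.inr (Set.mem_biUnion hw hz)
    rintro z (rfl | hz)
    · exact ⟨le_rfl, ho, Or.inr ⟨fun _ w hw => hsub w hw (hmem w hw), fun h => absurd hX h⟩⟩
    · simp only [Set.mem_iUnion] at hz
      obtain ⟨w, hw, hz⟩ := hz
      obtain ⟨h1, h2, h3⟩ := hN w hw z hz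
      exact ⟨le_self_add.trans h1, h2, h3.imp_right fun h => h.mono (hsub w hw)⟩
  | some u w d hX ho hw _ ih =>
    obtain ⟨N, hfin, hmem, hN⟩ := ih
    refine ⟨insert (u, d) N, hfin.insert _, Set.mem_insert _ _, ?_⟩
    rintro z (rfl | hz)
    · exact ⟨le_rfl, ho, Or.inr ⟨fun h => absurd h hX, fun _ => ⟨w, hw, Or.inr hmem⟩⟩⟩
    · obtain ⟨h1, h2, h3⟩ := hN z hz
      exact ⟨le_self_add.trans h1, h2, h3.imp_right fun h => h.mono (Set.subset_insert _ _)⟩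

/-- If from every state in `R` the opponent can force the cost up to every `y < c` within `ok`,
ending in `R` again, then all this can be arranged in a locally finite set of states. -/
lemma exists_closed (hA : IsArena E X ρ) {c : ℝ≥0∞} {ok R : ℕ → ℝ≥0∞ → Prop}
    (hok : ∀ u d, R u d → ok u d)
    (hR : ∀ u d, R u d → ∀ y < c, Force E X ρ ok (fun u d => c ≤ d ∨ y ≤ d ∧ R u d) u d)
    {u₀ : ℕ} {d₀ : ℝ≥0∞} (h₀ : R u₀ d₀) :
    ∃ N : Set (ℕ × ℝ≥0∞), (u₀, d₀) ∈ N ∧ (∀ z ∈ N, d₀ ≤ z.2 ∧ ok z.1 z.2) ∧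
      (∀ y < c, {z ∈ N | z.2 ≤ y}.Finite) ∧ ∀ z ∈ N, z.2 < c → ClosedAt E X ρ N z := by
  rcases le_or_gt c d₀ with hc | hc
  · refine ⟨{(u₀, d₀)}, rfl, ?_, fun y _ => (Set.finite_singleton _).subset fun z hz => hz.1, ?_⟩
    · rintro z rfl
      exact ⟨le_rfl, hok _ _ h₀⟩
    · rintro z rfl hz
      exact absurd hz hc.not_gt
  obtain ⟨y, hymono, hyc, hylim⟩ := exists_seq_strictMono_tendsto' (bot_le.trans_lt hc)
  have hex : ∀ t < c, ∃ n, t < y n := fun t ht => (hylim.eventually (lt_mem_nhds ht)).exists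
  classical
  have hlev : ∀ t, ∃ n, t < c → t < y n ∧ ∀ m, t < y m → n ≤ m := fun t => by
    by_cases ht : t < c
    · exact ⟨Nat.find (hex t ht), fun _ => ⟨Nat.find_spec (hex t ht),
        fun m hm => Nat.find_min' (hex t ht) hm⟩⟩
    · exact ⟨0, fun h => absurd h ht⟩
  choose l hl using hlev
  have hN : ∀ z : ℕ × ℝ≥0∞, R z.1 z.2 → z.2 < c → ∃ N : Set (ℕ × ℝ≥0∞), N.Finite ∧ z ∈ N ∧
      ∀ x ∈ N, z.2 ≤ x.2 ∧ ok x.1 x.2 ∧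
        ((c ≤ x.2 ∨ y (l z.2) ≤ x.2 ∧ R x.1 x.2) ∨ ClosedAt E X ρ N x) :=
    fun z hz _ => (hR z.1 z.2 hz (y (l z.2)) (hyc _).2).exists_finite hA
  choose! N hNfin hNmem hN using hN
  set next : ℕ × ℝ≥0∞ → ℕ × ℝ≥0∞ → Prop :=
    fun z x => R z.1 z.2 ∧ z.2 < c ∧ x ∈ N z ∧ y (l z.2) ≤ x.2 ∧ R x.1 x.2 with hnext
  set F : Set (ℕ × ℝ≥0∞) := {x | Relation.ReflTransGen next (u₀, d₀) x} with hF
  have hFR : ∀ x ∈ F, R x.1 x.2 ∧ d₀ ≤ x.2 := by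
    intro x hx
    induction hx with
    | refl => exact ⟨h₀, le_rfl⟩
    | tail _ h ih => exact ⟨h.2.2.2.2, ih.2.trans ((hN _ h.1 h.2.1 _ h.2.2.1).1)⟩
  have hFfin : ∀ n, {x ∈ F | x.2 < y n}.Finite := by
    have hsub : ∀ n, ∀ x ∈ F, x.2 < y n →
        x = (u₀, d₀) ∨ ∃ z ∈ F, R z.1 z.2 ∧ z.2 < c ∧ x ∈ N z ∧ y (l z.2) < y n := by
      intro n x hx hxn
      rcases Relation.ReflTransGen.cases_tail hx with h | ⟨z, hz, h⟩
      · exact Or.inl h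
      · exact Or.inr ⟨z, hz, h.1, h.2.1, h.2.2.1, h.2.2.2.1.trans_lt hxn⟩
    intro n
    induction n with
    | zero =>
      refine (Set.finite_singleton (u₀, d₀)).subset fun x hx => ?_
      rcases hsub _ x hx.1 hx.2 with h | ⟨z, _, _, _, _, h⟩
      · exact h
      · exact absurd (hymono.lt_iff_lt.1 h) (Nat.not_lt_zero _)
    | succ n ih =>
      refine ((Set.finite_singleton (u₀, d₀)).union (ih.biUnion (t := N) fun z hz =>
        hNfin z (hFR z hz.1).1 (hz.2.trans (hyc n).2))).subset fun x hx => ?_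
      rcases hsub _ x hx.1 hx.2 with h | ⟨z, hz, hzR, hzc, hxz, h⟩
      · exact Or.inl h
      · refine Or.inr (Set.mem_biUnion ⟨hz, ?_⟩ hxz)
        exact (hl z.2 hzc).1.trans_le
          (hymono.monotone (Nat.le_of_lt_succ (hymono.lt_iff_lt.1 h)))
  have hmem₀ : (u₀, d₀) ∈ F := Relation.ReflTransGen.refl
  refine ⟨⋃ x ∈ {x ∈ F | x.2 < c}, N x, Set.mem_biUnion ⟨hmem₀, hc⟩ (hNmem _ h₀ hc), ?_, ?_, ?_⟩
  · intro z hz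
    simp only [Set.mem_iUnion] at hz
    obtain ⟨x, ⟨hx, hxc⟩, hz⟩ := hz
    obtain ⟨h1, h2, -⟩ := hN x (hFR x hx).1 hxc z hz
    exact ⟨(hFR x hx).2.trans h1, h2⟩
  · intro t ht
    obtain ⟨n, hn⟩ := hex t ht
    refine ((hFfin n).biUnion (t := N) fun z hz =>
        hNfin z (hFR z hz.1).1 (hz.2.trans (hyc n).2)).subset fun z hz => ?_
    obtain ⟨hz, hzt⟩ := hz
    simp only [Set.mem_iUnion] at hz
    obtain ⟨x, ⟨hx, hxc⟩, hz⟩ := hz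
    exact Set.mem_biUnion (x := x) ⟨hx, ((hN x (hFR x hx).1 hxc z hz).1.trans hzt).trans_lt hn⟩ hz
  · intro z hz hzc
    have hsub : ∀ x ∈ F, x.2 < c → N x ⊆ ⋃ x ∈ {x ∈ F | x.2 < c}, N x :=
      fun x hx hxc => Set.subset_biUnion_of_mem (u := N) (show x ∈ {x ∈ F | x.2 < c} from ⟨hx, hxc⟩)
    simp only [Set.mem_iUnion] at hz
    obtain ⟨x, ⟨hx, hxc⟩, hz⟩ := hz
    obtain ⟨-, -, (h | h) | h⟩ := hN x (hFR x hx).1 hxc z hz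
    · exact absurd hzc h.not_gt
    · have hzF : z ∈ F := Relation.ReflTransGen.tail hx ⟨(hFR x hx).1, hxc, hz, h⟩
      obtain ⟨-, -, (h' | h') | h'⟩ := hN z h.2 hzc z (hNmem z h.2 hzc)
      · exact absurd hzc h'.not_gt
      · exact absurd (hl z.2 hzc).1 h'.1.not_gt
      · exact h'.mono (hsub z hzF hzc)
    · exact h.mono (hsub x hx hxc)

/-- A locally finite closed set of states yields a positional strategy of the opponent, prescribed
on `P`, against which the owner of `X` pays at least `c`. -/
lemma exists_positional (hA : IsArena E X ρ) {c : ℝ≥0∞} {s : ℕ} {N : Set (ℕ × ℝ≥0∞)}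
    (hs : (s, 0) ∈ N) (hfin : ∀ y < c, {z ∈ N | z.2 ≤ y}.Finite)
    (hcl : ∀ z ∈ N, z.2 < c → ClosedAt E X ρ N z) (P : Set ℕ) (g : ℕ → ℕ)
    (hg : ∀ u ∈ P, (∃ w, E u w) → E u (g u))
    (hP : ∀ z ∈ N, z.2 < c → z.1 ∉ X → z.1 ∈ P → ∃ e ≤ z.2, (g z.1, e + ρ z.1 (g z.1)) ∈ N) :
    ∃ τ : ℕ → ℕ, (∀ u ∈ P, τ u = g u) ∧ (∀ u, (∃ w, E u w) → E u (τ u)) ∧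
      ∀ v, IsPlay E v → v 0 = s → (∀ n, v n ∉ X → ¬ IsTerm E (v n) → v (n + 1) = τ (v n)) →
        c ≤ totalCost E ρ v := by
  have key : ∀ u, ∃ w, (u ∈ P → w = g u) ∧ ((∃ w, E u w) → E u w) ∧
      (u ∉ X → ∀ d < c, (u, d) ∈ N → ∃ e ≤ d, (w, e + ρ u w) ∈ N) := by
    intro u
    by_cases hu : u ∈ P
    · exact ⟨g u, fun _ => rfl, hg u hu, fun hX d hd hm => hP (u, d) hm hd hX hu⟩
    by_cases hex : u ∉ X ∧ ∃ d < c, (u, d) ∈ N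
    · obtain ⟨hX, d, hd, hm⟩ := hex
      obtain ⟨z, ⟨⟨hzN, hzd⟩, hzu⟩, hzmin⟩ := Set.exists_min_image
        ({z ∈ N | z.2 ≤ d} ∩ {z | z.1 = u}) Prod.snd ((hfin d hd).inter_of_left _)
        ⟨(u, d), ⟨hm, le_rfl⟩, rfl⟩
      obtain rfl : z.1 = u := hzu
      obtain ⟨w, hw, hwN⟩ := (hcl z hzN (hzd.trans_lt hd)).2 hX
      refine ⟨w, fun h => absurd h hu, fun _ => hw, fun _ d' hd' hm' => ⟨z.2, ?_, hwN⟩⟩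
      rcases le_total d' d with h | h
      · exact hzmin (z.1, d') ⟨⟨hm', h⟩, rfl⟩
      · exact hzd.trans h
    · by_cases hu' : ∃ w, E u w
      · obtain ⟨w, hw⟩ := hu'
        exact ⟨w, fun h => absurd h hu, fun _ => hw, fun hX d hd hm => absurd ⟨hX, d, hd, hm⟩ hex⟩
      · exact ⟨0, fun h => absurd h hu, fun h => absurd h hu',
          fun hX d hd hm => absurd ⟨hX, d, hd, hm⟩ hex⟩
  choose τ hτP hτE hτ using key
  refine ⟨τ, hτP, hτE, fun v hv hv0 hvτ => ?_⟩
  by_contra! hlt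
  set T := totalCost E ρ v with hT
  have hle : ∀ n, elapsed E ρ v n ≤ T := elapsed_le_totalCost
  have hnt : ∀ z ∈ N, z.2 < c → ∃ w, E z.1 w := fun z hz hzc => by
    by_cases hX : z.1 ∈ X
    · exact hA.exists_succ _ hX
    · exact ((hcl z hz hzc).2 hX).imp fun _ h => h.1
  have harc : ∀ n e, e < c → (v n, e) ∈ N → E (v n) (v (n + 1)) := fun n e he hm => by
    obtain ⟨w, hw⟩ := hnt (v n, e) hm he
    exact (hv n).resolve_right fun h => h.1 w hw
  have inv : ∀ n, ∃ e ≤ elapsed E ρ v n, (v n, e) ∈ N := by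
    intro n
    induction n with
    | zero => exact ⟨0, zero_le, by rwa [hv0]⟩
    | succ n ih =>
      obtain ⟨e, he, hm⟩ := ih
      have hec : e < c := (he.trans (hle n)).trans_lt hlt
      have hE := harc n e hec hm
      rw [elapsed_succ_of_arc hE]
      by_cases hX : v n ∈ X
      · exact ⟨e + ρ (v n) (v (n + 1)), add_le_add he le_rfl, (hcl _ hm hec).1 hX _ hE⟩
      · have hn : v (n + 1) = τ (v n) := hvτ n hX fun h => h _ hE
        obtain ⟨e', he', hm'⟩ := hτ (v n) hX e hec hm
        rw [hn]
        exact ⟨e' + ρ (v n) (τ (v n)), add_le_add (he'.trans he) le_rfl, hm'⟩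
  have hS : {z ∈ N | z.2 ≤ T}.Finite := hfin T hlt
  set S : Set (ℕ × ℕ) := ⋃ z ∈ {z ∈ N | z.2 ≤ T}, (fun w => (z.1, w)) '' {w | E z.1 w} with hSdef
  have hSfin : S.Finite := hS.biUnion fun z _ => (hA.finite_succ z.1).image _
  have hSmem : ∀ n, (v n, v (n + 1)) ∈ S := fun n => by
    obtain ⟨e, he, hm⟩ := inv n
    have heT := he.trans (hle n)
    exact Set.mem_biUnion (x := (v n, e)) ⟨hm, heT⟩ ⟨_, harc n e (heT.trans_lt hlt) hm, rfl⟩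
  have hSarc : ∀ p ∈ S, E p.1 p.2 := by
    intro p hp
    simp only [hSdef, Set.mem_iUnion] at hp
    obtain ⟨z, _, w, hw, rfl⟩ := hp
    exact hw
  obtain ⟨p, hp, hpmin⟩ := Set.exists_min_image S (fun p => ρ p.1 p.2) hSfin ⟨_, hSmem 0⟩
  have hgrow : ∀ n : ℕ, n * ρ p.1 p.2 ≤ elapsed E ρ v n := by
    intro n
    induction n with
    | zero => simp
    | succ n ih =>
      rw [elapsed_succ_of_arc (hSarc _ (hSmem n)), Nat.cast_succ, add_mul, one_mul]
      exact add_le_add ih (hpmin _ (hSmem n))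
  obtain ⟨n, hn⟩ := ENNReal.exists_nat_mul_gt (hA.pos _ _ (hSarc p hp)).ne' hlt.ne_top
  exact absurd (hn.trans_le ((hgrow n).trans (hle n))) (lt_irrefl _)

end States

section Strategies

variable {E : ℕ → ℕ → Prop} {X : Set ℕ} {ρ : ℕ → ℕ → ℝ≥0∞} {Λ : Ordinal.{0}} {v : ℕ → ℕ}

/-- The opponent has a positional strategy which is compatible with the play `v` and deters the
owner of `X` from leaving it. -/
lemma IsLeaderPlay.exists_deterrent (hP : IsLeaderPlay E X ρ Λ v)
    (hpos : ∀ i j, v i = v j → v (i + 1) = v (j + 1)) :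
    ∃ τ : ℕ → ℕ, (∀ n, τ (v n) = v (n + 1)) ∧ (∀ u, (∃ w, E u w) → E u (τ u)) ∧
      ∀ v', IsPlay E v' → v' 0 = v 0 →
        (∀ n, v' n ∉ X → ¬ IsTerm E (v' n) → v' (n + 1) = τ (v' n)) →
        totalCost E ρ v ≤ totalCost E ρ v' := by
  have hA := hP.arena
  set c := totalCost E ρ v with hc
  have hN : ∀ i w, v i ∈ X → E (v i) w → ∃ N : Set (ℕ × ℝ≥0∞),
      (w, elapsed E ρ v i + ρ (v i) w) ∈ N ∧
      (∀ z ∈ N, elapsed E ρ v i ≤ z.2 ∧ OnTime E ρ v z.1 z.2) ∧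
      (∀ y < c, {z ∈ N | z.2 ≤ y}.Finite) ∧ ∀ z ∈ N, z.2 < c → ClosedAt E X ρ N z := by
    intro i w hX hw
    set R : ℕ → ℝ≥0∞ → Prop := fun u d => OnTime E ρ v u d ∧ ∀ y < c, Force E X ρ (OnTime E ρ v)
      (fun u d => c ≤ d ∨ y ≤ d ∧ Deterred E X ρ Λ v u d) u d with hR
    have hdet : ∀ u d, Deterred E X ρ Λ v u d → R u d := fun u d ⟨hd, q, hq, _⟩ =>
      ⟨hP.onTime_of_notAhead hq, fun y hy => hP.force_of_notAhead hd hq hy⟩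
    have hforce := fun y hy => hP.force_of_deviation (y := y) hX hw hy
    rcases eq_or_ne c 0 with h0 | h0
    · have hE : elapsed E ρ v (i + 1) = 0 := le_zero_iff.1 ((elapsed_le_totalCost _).trans h0.le)
      have harc := (hP.arcs i hX).arc
      rw [elapsed_succ_of_arc harc, add_eq_zero] at hE
      exact absurd hE.2 (hA.pos _ _ harc).ne'
    · have hon : OnTime E ρ v w (elapsed E ρ v i + ρ (v i) w) := by
        cases hforce 0 (pos_iff_ne_zero.2 h0) <;> assumption
      obtain ⟨N, h1, h2, h3, h4⟩ := exists_closed hA (R := R) (fun u d h => h.1)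
        (fun u d h y hy => (h.2 y hy).imp fun u d h => h.imp_right fun h => ⟨h.1, hdet u d h.2⟩)
        (⟨hon, hforce⟩ : R w (elapsed E ρ v i + ρ (v i) w))
      exact ⟨N, h1, fun z hz => ⟨le_self_add.trans (h2 z hz).1, (h2 z hz).2⟩, h3, h4⟩
  choose! N hNmem hNok hNfin hNcl using hN
  set D : Set (ℕ × ℕ) := {p | v p.1 ∈ X ∧ E (v p.1) p.2} with hD
  set U : Set (ℕ × ℝ≥0∞) :=
    Set.range (fun j => (v j, elapsed E ρ v j)) ∪ ⋃ p ∈ D, N p.1 p.2 with hU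
  have hUv : ∀ j, (v j, elapsed E ρ v j) ∈ U := fun j => Or.inl ⟨j, rfl⟩
  have hUN : ∀ p ∈ D, N p.1 p.2 ⊆ U := fun p hp z hz => Or.inr (Set.mem_biUnion hp hz)
  have hUfin : ∀ y < c, {z ∈ U | z.2 ≤ y}.Finite := by
    intro y hy
    obtain ⟨n, hn⟩ := lt_iSup_iff.1 hy
    have hlt : ∀ j, elapsed E ρ v j ≤ y → j < n := fun j hj => by
      by_contra! h
      exact absurd (hn.trans_le ((elapsed_mono h).trans hj)) (lt_irrefl _)
    have hDfin : (D ∩ {p | p.1 < n}).Finite := by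
      refine ((Set.finite_Iio n).biUnion fun i _ =>
        (hA.finite_succ (v i)).image fun w => (i, w)).subset fun p hp => ?_
      exact Set.mem_biUnion (x := p.1) hp.2 ⟨p.2, hp.1.2, rfl⟩
    refine (((Set.finite_Iio n).image fun j => (v j, elapsed E ρ v j)).union
      (hDfin.biUnion (t := fun p => {z ∈ N p.1 p.2 | z.2 ≤ y}) fun p hp =>
        hNfin p.1 p.2 hp.1.1 hp.1.2 y hy)).subset fun z hz => ?_
    obtain ⟨⟨j, rfl⟩ | hz, hzy⟩ := hz
    · exact Or.inl ⟨j, hlt j hzy, rfl⟩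
    · simp only [Set.mem_iUnion] at hz
      obtain ⟨p, hp, hz⟩ := hz
      exact Or.inr (Set.mem_biUnion (x := p)
        ⟨hp, hlt _ ((hNok p.1 p.2 hp.1 hp.2 z hz).1.trans hzy)⟩ ⟨hz, hzy⟩)
  have hnext : ∀ j, elapsed E ρ v j < c → E (v j) (v (j + 1)) := fun j hj =>
    (hP.play j).resolve_right fun h => hj.ne' (totalCost_eq_elapsed hP.play h.1)
  have hUcl : ∀ z ∈ U, z.2 < c → ClosedAt E X ρ U z := by
    rintro z (⟨j, rfl⟩ | hz) hzc
    · refine ⟨fun hX w hw => hUN (j, w) ⟨hX, hw⟩ (hNmem j w hX hw), fun _ => ?_⟩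
      refine ⟨v (j + 1), hnext j hzc, ?_⟩
      rw [← elapsed_succ_of_arc (hnext j hzc)]
      exact hUv (j + 1)
    · simp only [Set.mem_iUnion] at hz
      obtain ⟨p, hp, hz⟩ := hz
      exact (hNcl p.1 p.2 hp.1 hp.2 z hz hzc).mono (hUN p hp)
  have hUok : ∀ z ∈ U, OnTime E ρ v z.1 z.2 := by
    rintro z (⟨j, rfl⟩ | hz)
    · exact fun _ _ => ⟨j, rfl, le_rfl⟩
    · simp only [Set.mem_iUnion] at hz
      obtain ⟨p, hp, hz⟩ := hz
      exact (hNok p.1 p.2 hp.1 hp.2 z hz).2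
  have hg : ∀ u, ∃ w, ∀ n, v n = u → w = v (n + 1) := fun u => by
    by_cases hu : ∃ n, v n = u
    · obtain ⟨n, rfl⟩ := hu
      exact ⟨v (n + 1), fun m hm => (hpos m n hm).symm⟩
    · exact ⟨0, fun n hn => absurd ⟨n, hn⟩ hu⟩
  choose g hg using hg
  obtain ⟨τ, hτv, hτE, hτ⟩ := exists_positional hA (s := v 0)
    (by simpa [elapsed_zero] using hUv 0) hUfin hUcl (Set.range v) g (by
      rintro _ ⟨n, rfl⟩ ⟨w, hw⟩
      rw [hg _ n rfl]
      exact (hP.play n).resolve_right fun h => h.1 w hw) (by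
      rintro z hz hzc - ⟨j, hj⟩
      obtain ⟨i, hi, hle⟩ := hUok z hz j hj
      refine ⟨_, hle, ?_⟩
      rw [hg _ i hi, ← hi, ← elapsed_succ_of_arc (hnext i (hle.trans_lt hzc))]
      exact hUv (i + 1))
  exact ⟨τ, fun n => (hτv _ ⟨n, rfl⟩).trans (hg _ n rfl), hτE, hτ⟩

/-- From a vertex of infinite value the opponent has a positional strategy making every play
infinitely costly. -/
lemma exists_trap (hA : IsArena E X ρ)
    (hΛ : ∀ u w, optArcs E X ρ Λ u w → optVal E X ρ Λ u = ρ u w + optVal E X ρ Λ w) {s : ℕ}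
    (hs : optVal E X ρ Λ s = ⊤) :
    ∃ τ : ℕ → ℕ, (∀ u, (∃ w, E u w) → E u (τ u)) ∧ ∀ v, IsPlay E v → v 0 = s →
      (∀ n, v n ∉ X → ¬ IsTerm E (v n) → v (n + 1) = τ (v n)) → totalCost E ρ v = ⊤ := by
  set R : ℕ → ℝ≥0∞ → Prop := fun u d => d ≠ ⊤ ∧ optVal E X ρ Λ u = ⊤ with hR
  have hforce : ∀ (y : ℝ≥0∞) (k u : ℕ) (d : ℝ≥0∞), R u d →
      y < d + stepVal (optArcs E X ρ Λ) X ρ k u →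
      Force E X ρ (fun _ _ => True) (fun u d => ⊤ ≤ d ∨ y ≤ d ∧ R u d) u d := by
    intro y k
    induction k with
    | zero =>
      intro u d h hy
      exact .leaf u d trivial (Or.inr ⟨by simpa [stepVal] using hy.le, h⟩)
    | succ k ih =>
      intro u d h hy
      have hu : ∃ w, E u w := by
        by_contra hc
        have := h.2
        rw [optVal_eq_zero hA Λ hc] at this
        exact ENNReal.zero_ne_top this
      by_cases hX : u ∈ X
      · refine .all u d hX trivial fun w hw => ?_
        obtain ⟨hm, htop⟩ := optArcs_of_optVal_eq_top hA hX hw h.2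
        refine ih w _ ⟨ENNReal.add_ne_top.2 ⟨h.1, hA.ne_top u w hw⟩, htop⟩ ?_
        rw [add_assoc]
        exact hy.trans_le (add_le_add le_rfl (stepVal_succ_le k hX hm))
      · obtain ⟨w, hm, he⟩ := exists_stepVal_succ_eq (X := X) (ρ := ρ) k
          (finite_optArcs hA Λ u) (exists_optArcs hA Λ hu)
        have hne := hA.ne_top u w hm.arc
        refine .some u w d hX trivial hm.arc (ih w _ ⟨ENNReal.add_ne_top.2 ⟨h.1, hne⟩, ?_⟩ ?_)
        · have h1 := hΛ u w hm
          rw [h.2] at h1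
          exact (ENNReal.add_eq_top.1 h1.symm).resolve_left hne
        · rw [add_assoc, ← he]
          exact hy
  obtain ⟨N, h1, -, h3, h4⟩ := exists_closed hA (c := ⊤) (ok := fun _ _ => True) (R := R)
    (fun _ _ _ => trivial) (fun u d h y hy => by
      have hlt : y < d + optVal E X ρ Λ u := by rwa [h.2, add_top]
      obtain ⟨k, hk⟩ := exists_lt_add_stepVal hlt
      exact hforce y k u d h hk) (⟨ENNReal.zero_ne_top, hs⟩ : R s 0)
  obtain ⟨τ, -, hτE, hτ⟩ := exists_positional hA h1 h3 h4 ∅ id (fun _ h => absurd h (by simp))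
    (fun _ _ _ _ h => absurd h (by simp))
  exact ⟨τ, hτE, fun v hv hv0 hvτ => top_le_iff.1 (hτ v hv hv0 hvτ)⟩

/-- The play from `s` following `f`, continued by staying forever at a terminal. -/
noncomputable def playFrom (E : ℕ → ℕ → Prop) (f : ℕ → ℕ) (s : ℕ) (n : ℕ) : ℕ :=
  (fun u => if IsTerm E u then u else f u)^[n] s

lemma playFrom_succ (f : ℕ → ℕ) (s n : ℕ) : playFrom E f s (n + 1) =
    if IsTerm E (playFrom E f s n) then playFrom E f s n else f (playFrom E f s n) := by
  rw [playFrom, Function.iterate_succ_apply']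
  rfl

lemma isPlay_playFrom {f : ℕ → ℕ} (hf : ∀ u, (∃ w, E u w) → E u (f u)) (s : ℕ) :
    IsPlay E (playFrom E f s) := by
  intro n
  rw [playFrom_succ]
  split_ifs with h
  · exact Or.inr ⟨h, rfl⟩
  · rw [IsTerm] at h
    push Not at h
    exact Or.inl (hf _ h)

/-- Best replies of the owner of `Y`: on the arcs of `H`, which allow exactly one move at
vertices outside `Y`, no play is cheaper than `limVal`. -/
lemma limVal_le_totalCost {Y : Set ℕ} {H : ℕ → ℕ → Prop}
    (hY : ∀ u ∈ Y, ∃ w, E u w) (hHE : ∀ u w, H u w → E u w) (hv : IsPlay E v)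
    (hH : ∀ n, E (v n) (v (n + 1)) → H (v n) (v (n + 1)))
    (huniq : ∀ n, v n ∉ Y → ∀ w, H (v n) w → w = v (n + 1)) :
    limVal H Y ρ (v 0) ≤ totalCost E ρ v := by
  have key : ∀ k m, elapsed E ρ v m + stepVal H Y ρ k (v m) ≤ elapsed E ρ v (m + k) := by
    intro k
    induction k with
    | zero => intro m; simp [stepVal]
    | succ k ih =>
      intro m
      rcases hv m with he | ⟨ht, -⟩
      · have h1 : stepVal H Y ρ (k + 1) (v m) ≤
            ρ (v m) (v (m + 1)) + stepVal H Y ρ k (v (m + 1)) := by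
          by_cases hm : v m ∈ Y
          · exact stepVal_succ_le k hm (hH m he)
          · rw [stepVal, if_neg hm]
            refine iSup₂_le fun w hw => ?_
            rw [huniq m hm w hw]
        refine (add_le_add le_rfl h1).trans ?_
        rw [← add_assoc, ← elapsed_succ_of_arc he, ← Nat.add_assoc, Nat.add_right_comm]
        exact ih (m + 1)
      · rw [stepVal_eq_zero _ (fun h => (hY _ h).elim fun w hw => ht w hw)
          fun w hw => ht w (hHE _ _ hw), add_zero]
        exact elapsed_mono (Nat.le_add_right _ _)
  refine iSup_le fun k => ?_
  have := key k 0
  rw [elapsed_zero, zero_add, zero_add] at this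
  exact this.trans (elapsed_le_totalCost k)

/-- The strategy profile `f` is an equilibrium of the game from `s` in which the owners of `X` and
`Y` pay `ρ` and `ρ'`. -/
def IsEquilibrium (E : ℕ → ℕ → Prop) (X Y : Set ℕ) (ρ ρ' : ℕ → ℕ → ℝ≥0∞) (s : ℕ)
    (f : ℕ → ℕ) : Prop :=
  (∀ u, (∃ w, E u w) → E u (f u)) ∧
  (∀ v, IsPlay E v → v 0 = s → (∀ n, v n ∈ Y → v (n + 1) = f (v n)) →
    totalCost E ρ (playFrom E f s) ≤ totalCost E ρ v) ∧
  (∀ v, IsPlay E v → v 0 = s → (∀ n, v n ∈ X → v (n + 1) = f (v n)) →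
    totalCost E ρ' (playFrom E f s) ≤ totalCost E ρ' v)

variable {Y : Set ℕ} {ρ' : ℕ → ℕ → ℝ≥0∞}

lemma exists_equilibrium_of_ne_top (hA : IsArena E X ρ) (hA' : IsArena E Y ρ')
    (hpart : ∀ u, ¬ IsTerm E u ↔ u ∈ X ∪ Y)
    (hΛ : ∀ u w, optArcs E X ρ Λ u w → optVal E X ρ Λ u = ρ u w + optVal E X ρ Λ w) {s : ℕ}
    (hs : optVal E X ρ Λ s ≠ ⊤) : ∃ f, IsEquilibrium E X Y ρ ρ' s f := by
  have hσ : ∀ u, ∃ w, (∃ w, E u w) → optArcs E X ρ Λ u w := fun u => by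
    by_cases hu : ∃ w, E u w
    · exact (exists_optArcs hA Λ hu).imp fun w hw _ => hw
    · exact ⟨0, fun h => absurd h hu⟩
  choose σ hσ using hσ
  set H : ℕ → ℕ → Prop := fun u w => E u w ∧ (u ∈ X → w = σ u) with hH
  have hHE : ∀ u w, H u w → E u w := fun u w h => h.1
  have hπ : ∀ u, ∃ w, (∃ w, E u w) → H u w ∧ limVal H Y ρ' u = ρ' u w + limVal H Y ρ' w := by
    intro u
    by_cases hu : ∃ w, E u w
    · have hex : ∃ w, H u w := by
        by_cases hX : u ∈ X
        · exact ⟨σ u, (hσ u hu).arc, fun _ => rfl⟩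
        · exact hu.imp fun w hw => ⟨hw, fun h => absurd h hX⟩
      exact (exists_limVal_eq ((hA.finite_succ u).subset fun w hw => hw.1) hex).imp
        fun w hw _ => hw
    · exact ⟨0, fun h => absurd h hu⟩
  choose π hπ using hπ
  set v := playFrom E π s with hv
  have hplay : IsPlay E v := isPlay_playFrom (fun u hu => (hπ u hu).1.1) s
  have hvsucc : ∀ n, v (n + 1) = if IsTerm E (v n) then v n else π (v n) :=
    fun n => playFrom_succ π s n
  have hvπ : ∀ n, ¬ IsTerm E (v n) → v (n + 1) = π (v n) := fun n hn => by
    rw [hvsucc, if_neg hn]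
  have hP : IsLeaderPlay E X ρ Λ v := by
    refine ⟨hA, hΛ, hplay, fun n hX => ?_, hs⟩
    have hu := hA.exists_succ _ hX
    have hn : ¬ IsTerm E (v n) := fun h => hu.elim fun w hw => h w hw
    rw [hvπ n hn, (hπ _ hu).1.2 hX]
    exact hσ _ hu
  obtain ⟨τ, hτv, hτE, hτ⟩ := hP.exists_deterrent fun i j hij => by rw [hvsucc, hvsucc, hij]
  set f : ℕ → ℕ := fun u => if u ∈ X then π u else τ u with hf
  have hfv : playFrom E f s = v := by
    funext n
    induction n with
    | zero => rfl
    | succ n ih =>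
      rw [playFrom_succ, ih]
      by_cases hn : IsTerm E (v n)
      · rw [if_pos hn, hvsucc, if_pos hn]
      · rw [if_neg hn]
        by_cases hX : v n ∈ X
        · rw [hvπ n hn, hf]
          exact if_pos hX
        · rw [← hτv n, hf]
          exact if_neg hX
  refine ⟨f, fun u hu => ?_, fun v' hv' h0 hY => ?_, fun v' hv' h0 hX => ?_⟩
  · by_cases hX : u ∈ X
    · rw [hf]
      simpa [hX] using (hπ u hu).1.1
    · rw [hf]
      simpa [hX] using hτE u hu
  · rw [hfv]
    refine hτ v' hv' h0 fun n hX hn => ?_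
    rw [hY n (((hpart _).1 hn).resolve_left hX), hf]
    exact if_neg hX
  · rw [hfv]
    have hcost : ∀ n, elapsed E ρ' v n + limVal H Y ρ' (v n) = limVal H Y ρ' s := by
      intro n
      induction n with
      | zero => rw [elapsed_zero, zero_add]; rfl
      | succ n ih =>
        rcases hplay n with he | ⟨ht, he⟩
        · rw [elapsed_succ_of_arc he, add_assoc, ← ih, hvπ n fun h => h _ he,
            (hπ _ ⟨_, he⟩).2]
        · rw [elapsed_succ_of_isTerm ht, he, ih]
    have hXσ : ∀ n, v' n ∈ X → v' (n + 1) = σ (v' n) := fun n hn => by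
      rw [hX n hn, ← (hπ _ (hA.exists_succ _ hn)).1.2 hn, hf]
      exact if_pos hn
    refine (iSup_le fun n => le_self_add.trans (hcost n).le).trans ?_
    rw [← h0]
    refine limVal_le_totalCost hA'.exists_succ hHE hv' (fun n he => ⟨he, hXσ n⟩)
      fun n hn w hw => ?_
    have hnX : v' n ∈ X :=
      ((hpart _).1 fun h => h w hw.1).resolve_right hn
    rw [hXσ n hnX, hw.2 hnX]

lemma IsEquilibrium.swap {s : ℕ} {f : ℕ → ℕ} (h : IsEquilibrium E X Y ρ ρ' s f) :
    IsEquilibrium E Y X ρ' ρ s f :=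
  ⟨h.1, h.2.2, h.2.1⟩

/-- Every positive two-person cost game with finite out-degrees has an equilibrium. -/
lemma exists_isEquilibrium (hA : IsArena E X ρ) (hA' : IsArena E Y ρ')
    (hpart : ∀ u, ¬ IsTerm E u ↔ u ∈ X ∪ Y) (s : ℕ) :
    ∃ f, IsEquilibrium E X Y ρ ρ' s f := by
  obtain ⟨Λ, hΛ⟩ := exists_stable_s13 E X ρ
  obtain ⟨Λ', hΛ'⟩ := exists_stable_s13 E Y ρ'
  by_cases h1 : optVal E X ρ Λ s = ⊤
  swap
  · exact exists_equilibrium_of_ne_top hA hA' hpart hΛ h1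
  by_cases h2 : optVal E Y ρ' Λ' s = ⊤
  swap
  · exact (exists_equilibrium_of_ne_top hA' hA (fun u => by rw [hpart, Set.union_comm])
      hΛ' h2).imp fun f hf => hf.swap
  obtain ⟨τ, hτE, hτ⟩ := exists_trap hA hΛ h1
  obtain ⟨τ', hτE', hτ'⟩ := exists_trap hA' hΛ' h2
  refine ⟨fun u => if u ∈ X then τ' u else τ u, fun u hu => ?_, fun v hv h0 hY => ?_,
    fun v hv h0 hX => ?_⟩
  · dsimp only
    split_ifs
    · exact hτE' u hu
    · exact hτE u hu
  · rw [hτ v hv h0 fun n hnX hn =>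
      (hY n (((hpart _).1 hn).resolve_left hnX)).trans (if_neg hnX)]
    exact le_top
  · rw [hτ' v hv h0 fun n hnY hn =>
      have hnX := ((hpart _).1 hn).resolve_right hnY
      (hX n hnX).trans (if_pos hnX)]
    exact le_top

end Strategies

section RealCosts

variable {E : ℕ → ℕ → Prop} {X : Set ℕ} {r : ℕ → ℕ → ℝ}

lemma isArena_ofReal (hfin : ∀ u, {w | E u w}.Finite) (hX : ∀ u ∈ X, ¬ IsTerm E u)
    (hpos : ∀ u w, E u w → 0 < r u w) : IsArena E X fun u w => ENNReal.ofReal (r u w) where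
  finite_succ := hfin
  exists_succ u hu := by
    have h := hX u hu
    rw [IsTerm] at h
    push Not at h
    exact h
  pos u w h := ENNReal.ofReal_pos.2 (hpos u w h)
  ne_top _ _ _ := ENNReal.ofReal_ne_top

lemma playFrom_eq_iterate {f : ℕ → ℕ} {s n : ℕ} (h : ∀ i < n, ¬ IsTerm E (f^[i] s)) :
    playFrom E f s n = f^[n] s := by
  induction n with
  | zero => rfl
  | succ n ih =>
    rw [playFrom_succ, ih fun i hi => h i (hi.trans n.lt_succ_self), if_neg (h n n.lt_succ_self),
      Function.iterate_succ_apply']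

lemma coe_elapsed_playFrom (hpos : ∀ u w, E u w → 0 < r u w) {f : ℕ → ℕ}
    (hf : ∀ u, (∃ w, E u w) → E u (f u)) {s n : ℕ} (h : ∀ i < n, ¬ IsTerm E (f^[i] s)) :
    (elapsed E (fun u w => ENNReal.ofReal (r u w)) (playFrom E f s) n : EReal) =
      (((Finset.range n).sum fun i => r (f^[i] s) (f^[i + 1] s) : ℝ) : EReal) := by
  have hnonneg : ∀ i ∈ Finset.range n, 0 ≤ r (f^[i] s) (f^[i + 1] s) := fun i hi => by
    have hi' := h i (Finset.mem_range.1 hi)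
    rw [IsTerm] at hi'
    push Not at hi'
    rw [Function.iterate_succ_apply']
    exact (hpos _ _ (hf _ hi')).le
  have hsum : elapsed E (fun u w => ENNReal.ofReal (r u w)) (playFrom E f s) n =
      ENNReal.ofReal ((Finset.range n).sum fun i => r (f^[i] s) (f^[i + 1] s)) := by
    rw [ENNReal.ofReal_sum_of_nonneg hnonneg, elapsed]
    refine Finset.sum_congr rfl fun i hi => ?_
    have hi' := Finset.mem_range.1 hi
    rw [playFrom_eq_iterate fun j hj => h j (hj.trans hi'),
      playFrom_eq_iterate fun j hj => h j ((Nat.le_of_lt_succ hj).trans_lt hi'), if_neg (h i hi')]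
  rw [hsum, EReal.coe_ennreal_ofReal, max_eq_left (Finset.sum_nonneg hnonneg)]

lemma playCostInf_eq (hpos : ∀ u w, E u w → 0 < r u w) {f : ℕ → ℕ}
    (hf : ∀ u, (∃ w, E u w) → E u (f u)) (s : ℕ) :
    playCostInf E r f s =
      (totalCost E (fun u w => ENNReal.ofReal (r u w)) (playFrom E f s) : EReal) := by
  rw [playCostInf]
  split_ifs with h
  · have hmin : ∀ i < Nat.find h, ¬ IsTerm E (f^[i] s) := fun i hi => Nat.find_min h hi
    rw [← coe_elapsed_playFrom hpos hf hmin, totalCost_eq_elapsed (isPlay_playFrom hf s)]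
    rw [playFrom_eq_iterate hmin]
    exact Nat.find_spec h
  · push Not at h
    have hcoe := fun n => coe_elapsed_playFrom hpos hf (s := s) (n := n) fun i _ => h i
    simp only [← hcoe]
    rw [totalCost]
    refine le_antisymm (iSup_le fun n => EReal.coe_ennreal_le_coe_ennreal_iff.2
      (elapsed_le_totalCost n)) ?_
    have hlim := (continuous_coe_ennreal_ereal.tendsto _).comp
      (tendsto_atTop_iSup (elapsed_mono (E := E) (ρ := fun u w => ENNReal.ofReal (r u w))
        (v := playFrom E f s)))
    exact le_of_tendsto' hlim fun n => le_iSup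
      (fun n => (elapsed E (fun u w => ENNReal.ofReal (r u w)) (playFrom E f s) n : EReal)) n

end RealCosts

/-- a positive two-person shortest-path game on a countably infinite digraph
(vertices `v₀, v₁, …` enumerated by `ℕ`, start `s = v₀`) in which every vertex has
finite out-degree has a Nash equilibrium in pure stationary strategies, provided each
finite truncated game `Γⁿ` (arcs leave only `v₀, …, v_{n−1}`; all further vertices are
terminals) has a Nash equilibrium in pure stationary strategies. -/
theorem infinite_SP_game_has_NE
    (E : ℕ → ℕ → Prop) (V1 V2 : Set ℕ) (r1 r2 : ℕ → ℕ → ℝ)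
    (hpart : ∀ v, ¬ IsTerm E v ↔ v ∈ V1 ∪ V2)
    (hdisj : Disjoint V1 V2)
    (hfin : ∀ u, {v | E u v}.Finite)
    (hpos : ∀ u v, E u v → 0 < r1 u v ∧ 0 < r2 u v)
    (htrunc : ∀ n : ℕ, ∃ σ1 σ2 : ℕ → ℕ,
      IsNE (fun u v => E u v ∧ u < n) (V1 ∩ Set.Iio n) (V2 ∩ Set.Iio n) r1 r2 0 σ1 σ2) :
    ∃ σ1 σ2 : ℕ → ℕ, IsNEInf E V1 V2 r1 r2 0 σ1 σ2 := by
  have hpos1 : ∀ u w, E u w → 0 < r1 u w := fun u w h => (hpos u w h).1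
  have hpos2 : ∀ u w, E u w → 0 < r2 u w := fun u w h => (hpos u w h).2
  have hnt : ∀ u, (∃ w, E u w) ↔ ¬ IsTerm E u := fun u => by
    rw [IsTerm]
    push Not
    rfl
  have hV1 : ∀ u ∈ V1, ¬ IsTerm E u := fun u hu => (hpart u).2 (Or.inl hu)
  have hV2 : ∀ u ∈ V2, ¬ IsTerm E u := fun u hu => (hpart u).2 (Or.inr hu)
  obtain ⟨f, hf, h1, h2⟩ := exists_isEquilibrium (isArena_ofReal hfin hV1 hpos1)
    (isArena_ofReal hfin hV2 hpos2) hpart 0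
  have hff : nextFun V1 f f = f := funext fun u => ite_self _
  have hsucc : ∀ (g : ℕ → ℕ) (n : ℕ), ¬ IsTerm E (playFrom E g 0 n) →
      playFrom E g 0 (n + 1) = g (playFrom E g 0 n) := fun g n hn => by
    rw [playFrom_succ, if_neg hn]
  refine ⟨f, f, fun u hu => hf u ((hnt u).2 (hV1 u hu)), fun u hu => hf u ((hnt u).2 (hV2 u hu)),
    fun σ hσ => ?_, fun σ hσ => ?_⟩
  · have hg : ∀ u, (∃ w, E u w) → E u (nextFun V1 σ f u) := fun u hu => by
      by_cases h : u ∈ V1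
      · rw [nextFun, if_pos h]
        exact hσ u h
      · rw [nextFun, if_neg h]
        exact hf u hu
    rw [hff, playCostInf_eq hpos1 hf, playCostInf_eq hpos1 hg]
    refine EReal.coe_ennreal_le_coe_ennreal_iff.2 (h1 _ (isPlay_playFrom hg 0) rfl fun n hn => ?_)
    rw [hsucc _ _ (hV2 _ hn)]
    exact if_neg fun h => Set.disjoint_left.1 hdisj h hn
  · have hg : ∀ u, (∃ w, E u w) → E u (nextFun V1 f σ u) := fun u hu => by
      by_cases h : u ∈ V1
      · rw [nextFun, if_pos h]
        exact hf u hu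
      · rw [nextFun, if_neg h]
        exact hσ u (((hpart u).1 ((hnt u).1 hu)).resolve_left h)
    rw [hff, playCostInf_eq hpos2 hf, playCostInf_eq hpos2 hg]
    refine EReal.coe_ennreal_le_coe_ennreal_iff.2 (h2 _ (isPlay_playFrom hg 0) rfl fun n hn => ?_)
    rw [hsucc _ _ (hV1 _ hn)]
    exact if_pos hn
end
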